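/- arXiv:math/0203036 — 7 statements merged into one kernel-verified Lean document; each statement's English description precedes it below -/
import Mathlib

section
/- For all divergence-free derivations X₁, …, X₆ ∈ Derivation ℂ A₂ A₂, both of the following hold, all expressions computed among ℂ-linear endomorphisms of A₂ (hats denoting omitted arguments): (a) ∑_{1 ≤ i < j ≤ 6} (−1)^{i+j} • s₅(⁅Xᵢ, Xⱼ⁆, X₁, …, X̂ᵢ, …, X̂ⱼ, …, X₆) = 0, and (b) ∑_{i=1}^{6} (−1)^{i} • ⁅Xᵢ, s₅(X₁, …, X̂ᵢ, …, X₆)⁆ = 0. Hence the Chevalley–Eilenberg coboundary of s₅ vanishes: s₅ is a 5-cocycle of the adjoint module of the Lie algebra of divergence-free vector fields in two variables, and (Vect₀(2), {s₂, s₅}) is an sh-Lie algebra. -/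
noncomputable section

/-- Vector fields in `n` variables: `ℂ`-derivations of the polynomial ring `A_n`. -/
abbrev Vect (n : ℕ) : Type :=
  Derivation ℂ (MvPolynomial (Fin n) ℂ) (MvPolynomial (Fin n) ℂ)

/-- `s_k(T₁,…,T_k) = ∑_{σ} (sign σ) • T_{σ(k)} ∘ ⋯ ∘ T_{σ(1)}`, so that `T_{σ(1)}` acts first. -/
def sEnd {A : Type*} [AddCommGroup A] [Module ℂ A] {k : ℕ}
    (T : Fin k → Module.End ℂ A) : Module.End ℂ A :=
  ∑ σ : Equiv.Perm (Fin k),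
    (Equiv.Perm.sign σ : ℤ) • (List.ofFn fun i : Fin k => T (σ i)).reverse.prod

/-- The right-symmetric product `X ∘ᵣ Y` of vector fields: the unique derivation
sending each variable `xᵢ` to `Y (X xᵢ)`. -/
def rsym {n : ℕ} (X Y : Vect n) : Vect n :=
  MvPolynomial.mkDerivation ℂ fun i => Y (X (MvPolynomial.X i))

/-- Left-normed `rsym`-product of a list of vector fields. -/
def leftNormProd {n : ℕ} : List (Vect n) → Vect n
  | [] => 0
  | a :: t => t.foldl rsym a

/-- `s_k^{rsym}(X₁,…,X_k)`: alternating sum of left-normed right-symmetric products. -/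
def sRsym {n k : ℕ} (X : Fin k → Vect n) : Vect n :=
  ∑ σ : Equiv.Perm (Fin k),
    (Equiv.Perm.sign σ : ℤ) • leftNormProd (List.ofFn fun i : Fin k => X (σ i))

/-- Divergence of a vector field. -/
def divg {n : ℕ} (X : Vect n) : MvPolynomial (Fin n) ℂ :=
  ∑ i : Fin n, MvPolynomial.pderiv i (X (MvPolynomial.X i))

end

namespace S11

open Equiv

/-- lift of a permutation fixing zero -/
def liftP {n : ℕ} (τ : Perm (Fin n)) : Perm (Fin (n+1)) := Equiv.Perm.decomposeFin.symm (0, τ)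

lemma liftP_zero {n : ℕ} (τ : Perm (Fin n)) : liftP τ 0 = 0 := by
  simp [liftP]

lemma liftP_succ {n : ℕ} (τ : Perm (Fin n)) (k : Fin n) : liftP τ k.succ = (τ k).succ := by
  simp [liftP]

lemma sign_liftP {n : ℕ} (τ : Perm (Fin n)) : Perm.sign (liftP τ) = Perm.sign τ := by
  simp [liftP]

lemma liftP_inj {n : ℕ} {τ τ' : Perm (Fin n)} (h : liftP τ = liftP τ') : τ = τ' := by
  have := Equiv.Perm.decomposeFin.symm.injective h
  simpa using this

/-- alternating sum over permutations -/
def altS {M : Type*} [AddCommGroup M] {n : ℕ} (G : (Fin n → Fin n) → M) : M :=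
  ∑ σ : Perm (Fin n), (Perm.sign σ : ℤ) • G σ

lemma altS_first {M : Type*} [AddCommGroup M] {n : ℕ} (G : (Fin (n+1) → Fin (n+1)) → M) :
    altS G = ∑ i : Fin (n+1), (-1 : ℤ)^(i : ℕ) •
      altS (fun τ : Fin n → Fin n => G (Fin.cons i (fun k => i.succAbove (τ k)))) := by
  unfold altS
  simp_rw [Finset.smul_sum]
  rw [← Fintype.sum_prod_type']
  symm
  have hinj : Function.Injective (fun x : Fin (n+1) × Perm (Fin n) =>
      (x.1.cycleRange.symm * liftP x.2 : Perm (Fin (n+1)))) := by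
    rintro ⟨i, τ⟩ ⟨j, τ'⟩ h
    simp only at h
    have h0 : i = j := by
      have := congrArg (fun e : Perm (Fin (n+1)) => e 0) h
      simpa [liftP_zero] using this
    subst h0
    have := mul_left_cancel h
    rw [liftP_inj this]
  have hbij : Function.Bijective (fun x : Fin (n+1) × Perm (Fin n) =>
      (x.1.cycleRange.symm * liftP x.2 : Perm (Fin (n+1)))) := by
    rw [Fintype.bijective_iff_injective_and_card]
    refine ⟨hinj, ?_⟩
    simp [Fintype.card_perm, Nat.factorial_succ]
  refine Fintype.sum_bijective _ hbij _ _ ?_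
  rintro ⟨i, τ⟩
  have e1 : ((i.cycleRange.symm * liftP τ : Perm (Fin (n+1))) : Fin (n+1) → Fin (n+1)) =
      Fin.cons i (fun k => i.succAbove (τ k)) := by
    funext k
    refine Fin.cases ?_ (fun k => ?_) k
    · simp [liftP_zero]
    · simp [liftP_succ]
  simp only [e1]
  rw [smul_smul]
  congr 1
  simp [sign_liftP, Fin.sign_cycleRange]

lemma altS_place {M : Type*} [AddCommGroup M] {n : ℕ} (G : (Fin (n+1) → Fin (n+1)) → M) :
    altS G = ∑ p : Fin (n+1), (-1 : ℤ)^(p : ℕ) •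
      altS (fun τ : Fin n → Fin n =>
        G (p.insertNth (α := fun _ => Fin (n+1)) 0 (fun k => (τ k).succ))) := by
  unfold altS
  simp_rw [Finset.smul_sum]
  rw [← Fintype.sum_prod_type']
  symm
  have hinj : Function.Injective (fun x : Fin (n+1) × Perm (Fin n) =>
      (liftP x.2 * x.1.cycleRange : Perm (Fin (n+1)))) := by
    rintro ⟨i, τ⟩ ⟨j, τ'⟩ h
    simp only at h
    have h0 : i = j := by
      have := congrArg (fun e : Perm (Fin (n+1)) => e.symm 0) h
      have l0 : ∀ τ : Perm (Fin n), (liftP τ)⁻¹ 0 = 0 := fun τ => by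
        rw [Perm.inv_eq_iff_eq, liftP_zero]
      have l1 : ∀ (τ : Perm (Fin n)) (i : Fin (n+1)),
          (liftP τ * i.cycleRange : Perm (Fin (n+1))).symm 0 = i := fun τ i => by
        rw [Equiv.symm_apply_eq]
        simp [liftP_zero]
      simpa only [l1] using this
    subst h0
    have := mul_right_cancel h
    rw [liftP_inj this]
  have hbij : Function.Bijective (fun x : Fin (n+1) × Perm (Fin n) =>
      (liftP x.2 * x.1.cycleRange : Perm (Fin (n+1)))) := by
    rw [Fintype.bijective_iff_injective_and_card]
    refine ⟨hinj, ?_⟩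
    simp [Fintype.card_perm, Nat.factorial_succ]
  refine Fintype.sum_bijective _ hbij _ _ ?_
  rintro ⟨i, τ⟩
  have e1 : ((liftP τ * i.cycleRange : Perm (Fin (n+1))) : Fin (n+1) → Fin (n+1)) =
      i.insertNth (α := fun _ => Fin (n+1)) 0 (fun k => (τ k).succ) := by
    funext k
    refine Fin.succAboveCases i ?_ (fun k => ?_) k
    · simp [liftP_zero]
    · simp [liftP_succ]
  simp only [e1]
  rw [smul_smul]
  congr 1
  simp [sign_liftP, Fin.sign_cycleRange, mul_comm]

lemma altS_comp {M : Type*} [AddCommGroup M] {n : ℕ} (G : (Fin n → Fin n) → M)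
    (π : Perm (Fin n)) :
    altS (fun f => G (f ∘ π)) = (Perm.sign π : ℤ) • altS G := by
  unfold altS
  rw [Finset.smul_sum]
  refine Fintype.sum_equiv (Equiv.mulRight π) _ _ ?_
  intro σ
  simp only [Equiv.coe_mulRight, Perm.sign_mul, smul_smul, Perm.coe_mul]
  congr 1
  have := Int.units_mul_self (Perm.sign π)
  push_cast
  have h2 : ((Perm.sign π : ℤˣ) : ℤ) * ((Perm.sign π : ℤˣ) : ℤ) = 1 := by
    rw [← Units.val_mul, this]; rfl
  linear_combination (-(Perm.sign σ : ℤ)) * h2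

lemma altS_pre {M : Type*} [AddCommGroup M] {n : ℕ} (G : (Fin n → Fin n) → M)
    (π : Perm (Fin n)) :
    altS (fun f => G (π ∘ f)) = (Perm.sign π : ℤ) • altS G := by
  unfold altS
  rw [Finset.smul_sum]
  refine Fintype.sum_equiv (Equiv.mulLeft π) _ _ ?_
  intro σ
  simp only [Equiv.coe_mulLeft, Perm.sign_mul, smul_smul, Perm.coe_mul]
  congr 1
  have := Int.units_mul_self (Perm.sign π)
  push_cast
  have h2 : ((Perm.sign π : ℤˣ) : ℤ) * ((Perm.sign π : ℤˣ) : ℤ) = 1 := by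
    rw [← Units.val_mul, this]; rfl
  linear_combination (-(Perm.sign σ : ℤ)) * h2

lemma pair_sum {M : Type*} [AddCommGroup M] (Ψ : Fin 6 → Fin 6 → M) :
    ∑ i : Fin 6, (-1 : ℤ)^(i : ℕ) • ∑ j : Fin 5, (-1 : ℤ)^(j : ℕ) • Ψ i (i.succAbove j) =
    ∑ i : Fin 6, ∑ j : Fin 6, if i < j then (-1 : ℤ)^((i : ℕ) + (j : ℕ)) • (Ψ j i - Ψ i j) else 0 := by
  have hs : ∀ (i : Fin 6) (j : Fin 5), i.succAbove j =
      (![![1,2,3,4,5],![0,2,3,4,5],![0,1,3,4,5],![0,1,2,4,5],![0,1,2,3,5],![0,1,2,3,4]] :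
        Fin 6 → Fin 5 → Fin 6) i j := by decide
  simp only [hs, Fin.sum_univ_six, Fin.sum_univ_five]
  simp (decide := true) only [if_true, if_false]
  simp
  abel

/-- the indices other than `i`, `j` -/
def restF (i j : Fin 6) : Fin 4 → Fin 6 := fun l =>
  if h : i < j then j.succAbove ((⟨(i : ℕ), by omega⟩ : Fin 5).succAbove l)
  else if h' : j < i then i.succAbove ((⟨(j : ℕ), by omega⟩ : Fin 5).succAbove l)
  else 0

lemma restF_succAbove : ∀ (i : Fin 6) (j : Fin 5) (l : Fin 4),
    i.succAbove (j.succAbove l) = restF i (i.succAbove j) l := by decide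

lemma restF_symm : ∀ (i j : Fin 6) (l : Fin 4), restF i j l = restF j i l := by decide

lemma altS_pair {M : Type*} [AddCommGroup M] (K : Fin 6 → Fin 6 → (Fin 4 → Fin 6) → M) :
    altS (fun f : Fin 6 → Fin 6 => K (f 0) (f 1) (fun k => f k.succ.succ)) =
    ∑ i : Fin 6, ∑ j : Fin 6, if i < j then (-1 : ℤ)^((i : ℕ) + (j : ℕ)) •
      altS (fun τ : Fin 4 → Fin 4 =>
        K j i (fun k => restF i j (τ k)) - K i j (fun k => restF i j (τ k))) else 0 := by
  have h := pair_sum (fun i j => altS (fun τ : Fin 4 → Fin 4 => K i j (fun k => restF i j (τ k))))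
  have e : ∀ i j, (fun (τ : Fin 4 → Fin 4) (k : Fin 4) => restF j i (τ k)) =
      fun (τ : Fin 4 → Fin 4) (k : Fin 4) => restF i j (τ k) := by
    intro i j; funext τ k; exact restF_symm _ _ _
  have hsub : ∀ i j : Fin 6, altS (fun τ : Fin 4 → Fin 4 =>
        K j i (fun k => restF i j (τ k)) - K i j (fun k => restF i j (τ k))) =
      altS (fun τ : Fin 4 → Fin 4 => K j i (fun k => restF j i (τ k))) -
      altS (fun τ : Fin 4 → Fin 4 => K i j (fun k => restF i j (τ k))) := by
    intro i j
    simp only [altS, smul_sub, Finset.sum_sub_distrib]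
    congr 1
    refine Finset.sum_congr rfl fun τ _ => ?_
    have := congrFun (e j i) τ
    simp only [this]
  simp only [hsub]
  rw [← h, altS_first]
  refine Finset.sum_congr rfl fun i _ => ?_
  rw [altS_first]
  congr 1
  refine Finset.sum_congr rfl fun j _ => ?_
  congr 1
  congr 1
  funext τ
  have : (fun k => restF i (i.succAbove j) (τ k)) = fun k => i.succAbove (j.succAbove (τ k)) := by
    funext k; rw [restF_succAbove]
  rw [this]
  rfl

section generic
variable {A : Type*} [AddCommGroup A] [Module ℂ A]

/-- word -/
def W6 (a b c d e f : Module.End ℂ A) : Module.End ℂ A := f * (e * (d * (c * (b * a))))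

lemma sEnd6 (T : Fin 6 → Module.End ℂ A) :
    sEnd T = altS (fun f : Fin 6 → Fin 6 =>
      W6 (T (f 0)) (T (f 1)) (T (f 2)) (T (f 3)) (T (f 4)) (T (f 5))) := by
  unfold sEnd altS
  refine Finset.sum_congr rfl fun σ _ => ?_
  congr 1

lemma sEnd5 (T : Fin 5 → Module.End ℂ A) :
    sEnd T = altS (fun f : Fin 5 → Fin 5 =>
      T (f 4) * (T (f 3) * (T (f 2) * (T (f 1) * (T (f 0)))))) := by
  unfold sEnd altS
  refine Finset.sum_congr rfl fun σ _ => ?_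
  congr 1

lemma altS_mul_right {n : ℕ} (G : (Fin n → Fin n) → Module.End ℂ A) (c : Module.End ℂ A) :
    altS G * c = altS (fun f => G f * c) := by
  simp only [altS, Finset.sum_mul, smul_mul_assoc]

lemma altS_mul_left {n : ℕ} (G : (Fin n → Fin n) → Module.End ℂ A) (c : Module.End ℂ A) :
    c * altS G = altS (fun f => c * G f) := by
  simp only [altS, Finset.mul_sum, mul_smul_comm]

lemma partb (T : Fin 6 → Module.End ℂ A) (h : sEnd T = 0) :
    ∑ i : Fin 6, ((-1 : ℤ) ^ ((i : ℕ) + 1)) •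
        ⁅T i, sEnd (fun l : Fin 5 => T (Fin.succAbove i l))⁆ = 0 := by
  have h1 : ∑ i : Fin 6, (-1 : ℤ) ^ (i : ℕ) •
      (sEnd (fun l : Fin 5 => T (Fin.succAbove i l)) * T i) = 0 := by
    rw [← h, sEnd6, altS_first]
    refine Finset.sum_congr rfl fun i _ => ?_
    rw [sEnd5, altS_mul_right]
    congr 1
  have h2 : ∑ i : Fin 6, (-1 : ℤ) ^ (i : ℕ) •
      (T i * sEnd (fun l : Fin 5 => T (Fin.succAbove i l))) = 0 := by
    have h3 := altS_comp (fun f : Fin 6 → Fin 6 =>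
      W6 (T (f 0)) (T (f 1)) (T (f 2)) (T (f 3)) (T (f 4)) (T (f 5))) (finRotate 6)
    rw [← sEnd6, h, smul_zero, altS_first] at h3
    rw [← h3]
    refine Finset.sum_congr rfl fun i _ => ?_
    rw [sEnd5, altS_mul_left]
    congr 1
  have : ∀ i : Fin 6, ((-1 : ℤ) ^ ((i : ℕ) + 1)) •
        ⁅T i, sEnd (fun l : Fin 5 => T (Fin.succAbove i l))⁆ =
      (-1 : ℤ) ^ (i : ℕ) • (sEnd (fun l : Fin 5 => T (Fin.succAbove i l)) * T i) -
      (-1 : ℤ) ^ (i : ℕ) • (T i * sEnd (fun l : Fin 5 => T (Fin.succAbove i l))) := by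
    intro i
    rw [Ring.lie_def, pow_succ, mul_neg_one, neg_smul, ← smul_neg, neg_sub, smul_sub]
  simp only [this, Finset.sum_sub_distrib, h1, h2, sub_zero]

/-- words of length five with a distinguished letter at each place -/
def Q (p : Fin 5) (c : Module.End ℂ A) (r : Fin 4 → Module.End ℂ A) : Module.End ℂ A :=
  match p with
  | 0 => r 3 * (r 2 * (r 1 * (r 0 * c)))
  | 1 => r 3 * (r 2 * (r 1 * (c * r 0)))
  | 2 => r 3 * (r 2 * (c * (r 1 * r 0)))
  | 3 => r 3 * (c * (r 2 * (r 1 * r 0)))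
  | 4 => c * (r 3 * (r 2 * (r 1 * r 0)))

lemma sEnd_cons (c : Module.End ℂ A) (Y : Fin 4 → Module.End ℂ A) :
    sEnd (Fin.cons c Y : Fin 5 → Module.End ℂ A) =
      ∑ p : Fin 5, (-1 : ℤ)^(p : ℕ) • altS (fun τ : Fin 4 → Fin 4 => Q p c (fun k => Y (τ k))) := by
  rw [sEnd5, altS_place]
  refine Finset.sum_congr rfl fun p _ => ?_
  congr 1
  congr 1
  funext τ
  fin_cases p <;> rfl

/-- shuffles -/
def piP (p : Fin 5) : Perm (Fin 6) :=
  match p with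
  | 0 => 1
  | 1 => ⟨![2,0,1,3,4,5], ![1,2,0,3,4,5], by decide, by decide⟩
  | 2 => ⟨![2,3,0,1,4,5], ![2,3,0,1,4,5], by decide, by decide⟩
  | 3 => ⟨![2,3,4,0,1,5], ![3,4,0,1,2,5], by decide, by decide⟩
  | 4 => ⟨![2,3,4,5,0,1], ![4,5,0,1,2,3], by decide, by decide⟩

lemma Q_sub (p : Fin 5) (c d : Module.End ℂ A) (r : Fin 4 → Module.End ℂ A) :
    Q p (c - d) r = Q p c r - Q p d r := by
  fin_cases p <;> simp [Q, mul_sub, sub_mul]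

lemma parta (T : Fin 6 → Module.End ℂ A) (h : sEnd T = 0) :
    ∑ i : Fin 6, ∑ j : Fin 6, (if i < j then (-1 : ℤ) ^ ((i : ℕ) + (j : ℕ)) •
      sEnd (Fin.cons ⁅T i, T j⁆ (fun l => T (restF i j l)) : Fin 5 → Module.End ℂ A) else 0) = 0 := by
  have key : ∀ p : Fin 5, ∑ i : Fin 6, ∑ j : Fin 6,
      (if i < j then (-1 : ℤ) ^ ((i : ℕ) + (j : ℕ)) •
        altS (fun τ : Fin 4 → Fin 4 => Q p ⁅T i, T j⁆ (fun k => T (restF i j (τ k)))) else 0) = 0 := by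
    intro p
    have h3 := altS_comp (fun f : Fin 6 → Fin 6 =>
      W6 (T (f 0)) (T (f 1)) (T (f 2)) (T (f 3)) (T (f 4)) (T (f 5))) (piP p)
    rw [← sEnd6, h, smul_zero] at h3
    have h4 := altS_pair (fun a b r => Q p (T b * T a) (fun k => T (r k)))
    simp only [← Q_sub, ← Ring.lie_def] at h4
    rw [← h4, ← h3]
    congr 1
    funext f
    fin_cases p <;> simp only [Q, W6, mul_assoc] <;> rfl
  have : ∀ i j : Fin 6, (if i < j then (-1 : ℤ) ^ ((i : ℕ) + (j : ℕ)) •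
      sEnd (Fin.cons ⁅T i, T j⁆ (fun l => T (restF i j l)) : Fin 5 → Module.End ℂ A) else 0) =
      ∑ p : Fin 5, (-1 : ℤ)^(p : ℕ) • (if i < j then (-1 : ℤ) ^ ((i : ℕ) + (j : ℕ)) •
        altS (fun τ : Fin 4 → Fin 4 => Q p ⁅T i, T j⁆ (fun k => T (restF i j (τ k)))) else 0) := by
    intro i j
    split_ifs with hij
    · rw [sEnd_cons, Finset.smul_sum]
      refine Finset.sum_congr rfl fun p _ => ?_
      rw [smul_comm]
    · simp
  simp only [this]
  have sw : ∀ i : Fin 6, ∀ F : Fin 6 → Fin 5 → Module.End ℂ A,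
    ∑ j : Fin 6, ∑ p : Fin 5, F j p = ∑ p : Fin 5, ∑ j : Fin 6, F j p := fun i F => Finset.sum_comm
  simp only [sw 0]
  simp only [← Finset.smul_sum, key, smul_zero, Finset.sum_const_zero]

end generic

open MvPolynomial

abbrev A2 : Type := MvPolynomial (Fin 2) ℂ

/-- Hamiltonian vector field -/
noncomputable def ham (H : A2) : Vect 2 := pderiv 0 H • pderiv 1 - pderiv 1 H • pderiv 0

lemma ham_apply (H f : A2) : ham H f = pderiv 0 H * pderiv 1 f - pderiv 1 H * pderiv 0 f := rfl

/-- as a linear map -/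
noncomputable def hamL : A2 →ₗ[ℂ] Module.End ℂ A2 where
  toFun H := (ham H).toLinearMap
  map_add' H K := by
    refine LinearMap.ext fun f => ?_
    change ham (H + K) f = ham H f + ham K f
    simp only [ham_apply, map_add]
    ring
  map_smul' c H := by
    refine LinearMap.ext fun f => ?_
    change ham (c • H) f = c • ham H f
    simp only [ham_apply, Derivation.map_smul, smul_mul_assoc, smul_sub]

lemma hamL_apply (H f : A2) : hamL H f = pderiv 0 H * pderiv 1 f - pderiv 1 H * pderiv 0 f := rfl

/-- monomial -/
noncomputable def mon (a : ℕ × ℕ) : A2 := X 0 ^ a.1 * X 1 ^ a.2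

/-- antiderivative in variable i -/
noncomputable def anti (i : Fin 2) : A2 →ₗ[ℂ] A2 :=
  (basisMonomials (Fin 2) ℂ).constr ℂ (fun s => monomial (s + Finsupp.single i 1) ((s i + 1 : ℂ)⁻¹))

lemma anti_monomial (i : Fin 2) (s : Fin 2 →₀ ℕ) :
    anti i (monomial s 1) = monomial (s + Finsupp.single i 1) ((s i + 1 : ℂ)⁻¹) := by
  have := (basisMonomials (Fin 2) ℂ).constr_basis ℂ
    (fun s => (monomial (s + Finsupp.single i 1) ((s i + 1 : ℂ)⁻¹) : A2)) s
  rwa [coe_basisMonomials] at this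

lemma pderiv_anti (i : Fin 2) (f : A2) : pderiv i (anti i f) = f := by
  suffices h : (pderiv i).toLinearMap ∘ₗ anti i = LinearMap.id from congrArg (fun L => L f) h
  refine (basisMonomials (Fin 2) ℂ).ext fun s => ?_
  have : (s i + 1 : ℂ) ≠ 0 := Nat.cast_add_one_ne_zero _
  simp [anti_monomial, pderiv_monomial, this]

lemma pderiv_anti_comm {i j : Fin 2} (hij : i ≠ j) (f : A2) :
    pderiv j (anti i f) = anti i (pderiv j f) := by
  suffices h : (pderiv j).toLinearMap ∘ₗ anti i = anti i ∘ₗ (pderiv j).toLinearMap from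
    congrArg (fun L => L f) h
  refine (basisMonomials (Fin 2) ℂ).ext fun s => ?_
  have e : (monomial (s - Finsupp.single j 1) (s j : ℂ) : A2) =
      (s j : ℂ) • monomial (s - Finsupp.single j 1) 1 := by
    rw [smul_monomial, smul_eq_mul, mul_one]
  simp only [LinearMap.comp_apply, coe_basisMonomials, anti_monomial,
    Derivation.coeFn_coe, pderiv_monomial, one_mul]
  rw [e, map_smul, anti_monomial, smul_monomial]
  have h0 : Finsupp.single i 1 j = 0 := by simp [hij]
  have h1 : Finsupp.single j 1 i = 0 := by simp [hij.symm]
  simp only [Finsupp.add_apply, Finsupp.tsub_apply, h0, h1, add_zero, tsub_zero, smul_eq_mul]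
  rw [mul_comm]
  by_cases hs : s j = 0
  · simp [hs]
  · refine congrArg (fun t => monomial t _) ?_
    refine Finsupp.ext fun k => ?_
    fin_cases k <;> fin_cases i <;> fin_cases j <;> simp_all

lemma pderiv_comm' (i j : Fin 2) (f : A2) : pderiv i (pderiv j f) = pderiv j (pderiv i f) := by
  have h : ⁅(pderiv i : Vect 2), (pderiv j : Vect 2)⁆ = 0 := by
    refine derivation_ext fun k => ?_
    rw [Derivation.commutator_apply]
    simp [pderiv_X, Pi.single_apply]
    split_ifs <;> simp
  have := congrArg (fun D : Vect 2 => D f) h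
  simp only [Derivation.commutator_apply, Derivation.zero_apply] at this
  exact sub_eq_zero.mp this

lemma exists_ham (D : Vect 2) (h : divg D = 0) : ∃ H, D = ham H := by
  simp only [divg, Fin.sum_univ_two] at h
  set u := D (X 0) with hu
  set v := D (X 1) with hv
  -- u = -∂₁ H, v = ∂₀ H
  set w := v + pderiv 0 (anti 1 u) with hw
  have hw1 : pderiv 1 w = 0 := by
    rw [hw, map_add, pderiv_comm', pderiv_anti, add_comm, h]
  refine ⟨anti 0 w - anti 1 u, derivation_ext fun k => ?_⟩
  fin_cases k
  · simp [ham_apply, pderiv_anti, pderiv_anti_comm, hw1, ← hu, pderiv_X, Pi.single_apply]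
  · simp [ham_apply, pderiv_anti, pderiv_anti_comm, hw1, ← hv, pderiv_X, Pi.single_apply, hw]

/-- translation -/
noncomputable def trans (p : Fin 2 → ℂ) : A2 →ₐ[ℂ] A2 := aeval (fun i => X i + C (p i))

lemma pderiv_trans (p : Fin 2 → ℂ) (i : Fin 2) (f : A2) :
    pderiv i (trans p f) = trans p (pderiv i f) := by
  induction f using MvPolynomial.induction_on with
  | C a => simp [trans]
  | add f g hf hg => simp [hf, hg]
  | mul_X f k hf =>
    simp only [map_mul, Derivation.leibniz, hf, smul_eq_mul, map_add]
    congr 2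
    simp [trans, pderiv_X, Pi.single_apply]

lemma hamL_trans (p : Fin 2 → ℂ) (H f : A2) : hamL (trans p H) (trans p f) = trans p (hamL H f) := by
  simp [hamL_apply, pderiv_trans]

lemma eval_trans (p : Fin 2 → ℂ) (f : A2) : constantCoeff (trans p f) = eval p f := by
  induction f using MvPolynomial.induction_on with
  | C a => simp [trans]
  | add f g hf hg => simp [hf, hg]
  | mul_X f k hf => 
    simp only [map_mul, hf]
    simp [trans]

lemma sEnd_apply6 (T : Fin 6 → Module.End ℂ A2) (f : A2) :
    sEnd T f = ∑ σ : Perm (Fin 6), (Perm.sign σ : ℤ) •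
      T (σ 5) (T (σ 4) (T (σ 3) (T (σ 2) (T (σ 1) (T (σ 0) f))))) := by
  rw [sEnd6, altS, LinearMap.sum_apply]
  rfl

lemma sEnd_trans (p : Fin 2 → ℂ) (H : Fin 6 → A2) (f : A2) :
    sEnd (fun i => hamL (trans p (H i))) (trans p f) = trans p (sEnd (fun i => hamL (H i)) f) := by
  simp only [sEnd_apply6, hamL_trans, map_sum, map_zsmul]

/-- the alternating map -/
noncomputable def sAlt : Module.End ℂ A2 [⋀^Fin 6]→ₗ[ℂ] Module.End ℂ A2 :=
  MultilinearMap.alternatization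
    ((MultilinearMap.mkPiAlgebraFin ℂ 6 (Module.End ℂ A2)).domDomCongr Fin.revPerm)

lemma sAlt_apply (T : Fin 6 → Module.End ℂ A2) : sAlt T = sEnd T := by
  rw [sAlt, MultilinearMap.alternatization_apply, sEnd6, altS]
  refine Finset.sum_congr rfl fun σ _ => ?_
  simp only [MultilinearMap.domDomCongr_apply, MultilinearMap.mkPiAlgebraFin_apply]
  rw [Units.smul_def]
  congr 1

/-- one step on monomials -/
def step (s : ℤ × ℕ × ℕ) (a : ℕ × ℕ) : ℤ × ℕ × ℕ :=
  (s.1 * ((a.1 : ℤ) * s.2.2 - (a.2 : ℤ) * s.2.1), a.1 + s.2.1 - 1, a.2 + s.2.2 - 1)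

lemma hamL_mon (s : ℤ × ℕ × ℕ) (a : ℕ × ℕ) :
    hamL (mon a) (s.1 • mon s.2) = (step s a).1 • mon (step s a).2 := by
  obtain ⟨c, m, n⟩ := s
  obtain ⟨k, l⟩ := a
  rw [map_zsmul]
  simp only [step, mul_smul]
  congr 1
  simp only [hamL_apply, mon, pderiv_mul, pderiv_pow, pderiv_X]
  simp only [Pi.single_apply]
  simp
  rcases k with _ | k <;> rcases l with _ | l <;> rcases m with _ | m <;> rcases n with _ | n <;>
    simp [← Nat.add_assoc, pow_succ, pow_add] <;> ring_nf

lemma step_spec (s : ℤ × ℕ × ℕ) (a : ℕ × ℕ) (h : (step s a).1 ≠ 0) :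
    s.1 ≠ 0 ∧ (step s a).2.1 + 1 = a.1 + s.2.1 ∧ (step s a).2.2 + 1 = a.2 + s.2.2 ∧
      a ≠ (0, 0) ∧ s.2 ≠ (0, 0) := by
  obtain ⟨c, m, n⟩ := s
  obtain ⟨k, l⟩ := a
  simp only [step] at h ⊢
  have h1 := left_ne_zero_of_mul h
  have h2 := right_ne_zero_of_mul h
  refine ⟨h1, ?_, ?_, ?_, ?_⟩
  · have : k + m ≠ 0 := by
      intro h0
      obtain ⟨rfl, rfl⟩ : k = 0 ∧ m = 0 := by omega
      simp at h2
    omega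
  · have : l + n ≠ 0 := by
      intro h0
      obtain ⟨rfl, rfl⟩ : l = 0 ∧ n = 0 := by omega
      simp at h2
    omega
  · rintro h0
    simp only [Prod.mk.injEq] at h0
    simp [h0.1, h0.2] at h2
  · rintro h0
    simp only [Prod.mk.injEq] at h0
    simp [h0.1, h0.2] at h2

/-- the state after six steps -/
def run6 (w : Fin 6 → ℕ × ℕ) (b : ℕ × ℕ) : ℤ × ℕ × ℕ :=
  step (step (step (step (step (step (1, b) (w 0)) (w 1)) (w 2)) (w 3)) (w 4)) (w 5)

/-- the constant coefficient -/
def fin6 (b : ℕ × ℕ) (w : Fin 6 → ℕ × ℕ) : ℤ :=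
  if (run6 w b).2 = (0, 0) then (run6 w b).1 else 0

lemma constantCoeff_mon (a : ℕ × ℕ) : constantCoeff (mon a) = if a = (0, 0) then 1 else 0 := by
  obtain ⟨k, l⟩ := a
  rcases k with _ | k <;> rcases l with _ | l <;> simp [mon]

lemma cc_word (w : Fin 6 → ℕ × ℕ) (b : ℕ × ℕ) :
    constantCoeff (hamL (mon (w 5)) (hamL (mon (w 4)) (hamL (mon (w 3)) (hamL (mon (w 2))
      (hamL (mon (w 1)) (hamL (mon (w 0)) (mon b))))))) = ((fin6 b w : ℤ) : ℂ) := by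
  have h : mon b = ((1 : ℤ), b).1 • mon ((1 : ℤ), b).2 := by simp
  rw [h, hamL_mon, hamL_mon, hamL_mon, hamL_mon, hamL_mon, hamL_mon]
  rw [map_zsmul, constantCoeff_mon, fin6, run6]
  split_ifs <;> simp

lemma fin6_spec (b : ℕ × ℕ) (w : Fin 6 → ℕ × ℕ) (h : fin6 b w ≠ 0) :
    (∀ i, w i ≠ (0, 0)) ∧ b ≠ (0, 0) ∧ ∑ i, (w i).1 + b.1 = 6 ∧ ∑ i, (w i).2 + b.2 = 6 := by
  unfold fin6 at h
  split_ifs at h with h0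
  · unfold run6 at h h0
    have p5 := step_spec _ _ h
    have p4 := step_spec _ _ p5.1
    have p3 := step_spec _ _ p4.1
    have p2 := step_spec _ _ p3.1
    have p1 := step_spec _ _ p2.1
    have p0 := step_spec _ _ p1.1
    obtain ⟨-, q51, q52, q53, -⟩ := p5
    obtain ⟨-, q41, q42, q43, -⟩ := p4
    obtain ⟨-, q31, q32, q33, -⟩ := p3
    obtain ⟨-, q21, q22, q23, -⟩ := p2
    obtain ⟨-, q11, q12, q13, -⟩ := p1
    obtain ⟨-, q01, q02, q03, q04⟩ := p0
    rw [h0] at q51 q52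
    simp only at q01 q02 q51 q52
    refine ⟨?_, q04, ?_, ?_⟩
    · intro i
      fin_cases i <;> assumption
    · rw [Fin.sum_univ_six]; omega
    · rw [Fin.sum_univ_six]; omega
  · exact absurd rfl h

/-- canonical tuples -/
def can (g : ℕ × ℕ) : Fin 6 → ℕ × ℕ := ![(1,0),(0,1),(2,0),(1,1),(0,2),g]

/-- fold of steps along a word -/
def fin6' : (n : ℕ) → (ℤ × ℕ × ℕ) → (Fin n → ℕ × ℕ) → ℤ
  | 0, s, _ => if s.2 = (0, 0) then s.1 else 0
  | n+1, s, w => fin6' n (step s (w 0)) (fun i => w i.succ)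

/-- recursive evaluation of the alternating sum -/
def evF : (n : ℕ) → (ℤ × ℕ × ℕ) → (Fin n → ℕ × ℕ) → ℤ
  | 0, s, _ => if s.2 = (0, 0) then s.1 else 0
  | n+1, s, w => if s.1 = 0 then 0 else ∑ i : Fin (n+1), (-1 : ℤ)^(i : ℕ) * evF n (step s (w i)) (fun k => w (i.succAbove k))

lemma fin6'_zero (n : ℕ) (s : ℤ × ℕ × ℕ) (w : Fin n → ℕ × ℕ) (h : s.1 = 0) : fin6' n s w = 0 := by
  induction n generalizing s with
  | zero => simp [fin6', h]
  | succ n ih => exact ih _ _ (by simp [step, h])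

lemma altS_evF (n : ℕ) (s : ℤ × ℕ × ℕ) (w : Fin n → ℕ × ℕ) :
    altS (fun g : Fin n → Fin n => fin6' n s (w ∘ g)) = evF n s w := by
  induction n generalizing s with
  | zero => simp [altS, fin6', evF]
  | succ n ih =>
    by_cases h : s.1 = 0
    · have : (fun g : Fin (n+1) → Fin (n+1) => fin6' (n+1) s (w ∘ g)) = fun _ => 0 := by
        funext g
        exact fin6'_zero _ _ _ h
      rw [this]
      simp [altS, evF, h]
    · rw [altS_first, evF, if_neg h]
      refine Finset.sum_congr rfl fun i _ => ?_
      rw [smul_eq_mul, ← ih]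
      rfl

lemma fin6_eq (b : ℕ × ℕ) (w : Fin 6 → ℕ × ℕ) : fin6 b w = fin6' 6 (1, b) w := rfl

lemma check1 : altS (fun g : Fin 6 → Fin 6 => fin6 (0,1) (can (2,1) ∘ g)) = 0 := by
  simp only [fin6_eq]
  rw [altS_evF]
  decide +kernel

lemma check2 : altS (fun g : Fin 6 → Fin 6 => fin6 (1,0) (can (1,2) ∘ g)) = 0 := by
  simp only [fin6_eq]
  rw [altS_evF]
  decide +kernel

/-- exponents of degree one and two -/
def T5 : Finset (ℕ × ℕ) := {(1,0),(0,1),(2,0),(1,1),(0,2)}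

lemma hfin (k l : ℕ) (hk : k ≤ 2) (hl : l ≤ 2) : (k, l) ∉ T5 → (k, l) ≠ (0, 0) →
    (2 - k, 2 - l) ≠ (0, 0) → (((2 - k, 2 - l) = (0, 1) ∧ (k, l) = (2, 1)) ∨
      ((2 - k, 2 - l) = (1, 0) ∧ (k, l) = (1, 2))) := by
  interval_cases k <;> interval_cases l <;> simp [T5]

lemma comb (w : Fin 6 → ℕ × ℕ) (hw : Function.Injective w) (b : ℕ × ℕ)
    (h0 : ∀ i, w i ≠ (0, 0)) (hb : b ≠ (0, 0)) (h1 : ∑ i, (w i).1 + b.1 = 6)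
    (h2 : ∑ i, (w i).2 + b.2 = 6) :
    ∃ g, (∀ i, ∃ j, can g j = w i) ∧ ((b = (0,1) ∧ g = (2,1)) ∨ (b = (1,0) ∧ g = (1,2))) := by
  set S : Finset (ℕ × ℕ) := Finset.univ.image w with hS
  have hcard : S.card = 6 := by rw [hS, Finset.card_image_of_injective _ hw]; simp
  have hsum : ∀ F : ℕ × ℕ → ℕ, ∑ a ∈ S, F a = ∑ i, F (w i) := fun F => by
    rw [hS, Finset.sum_image (fun x _ y _ h => hw h)]
  have hS0 : ∀ a ∈ S, a ≠ (0,0) := by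
    intro a ha
    simp only [hS, Finset.mem_image, Finset.mem_univ, true_and] at ha
    obtain ⟨i, rfl⟩ := ha
    exact h0 i
  have h1' : ∑ a ∈ S, a.1 + b.1 = 6 := by rw [hsum]; exact h1
  have h2' : ∑ a ∈ S, a.2 + b.2 = 6 := by rw [hsum]; exact h2
  have hb' : 1 ≤ b.1 + b.2 := by
    by_contra hc
    apply hb
    ext <;> simp <;> omega
  have hT : ∀ a : ℕ × ℕ, a ≠ (0,0) → a ∉ T5 → 3 - (a.1 + a.2) = 0 := by
    rintro ⟨k, l⟩ ha hat
    by_contra hc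
    have hk : k ≤ 2 := by simp at hc; omega
    have hl : l ≤ 2 := by simp at hc; omega
    interval_cases k <;> interval_cases l <;> simp_all [T5]
  have hg : 18 ≤ ∑ a ∈ S, (3 - (a.1 + a.2)) + (∑ a ∈ S, a.1 + ∑ a ∈ S, a.2) := by
    rw [← Finset.sum_add_distrib, ← Finset.sum_add_distrib]
    calc 18 = ∑ a ∈ S, 3 := by simp [hcard]
      _ ≤ _ := Finset.sum_le_sum fun a _ => by omega
  have hTS : T5 ⊆ S := by
    intro t ht
    by_contra hts
    have hle : ∑ a ∈ S, (3 - (a.1 + a.2)) ≤ ∑ a ∈ T5.erase t, (3 - (a.1 + a.2)) := by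
      calc ∑ a ∈ S, (3 - (a.1 + a.2)) = ∑ a ∈ S.filter (· ∈ T5), (3 - (a.1 + a.2)) := by
            rw [Finset.sum_filter]
            refine Finset.sum_congr rfl fun a ha => ?_
            split_ifs with h
            · rfl
            · exact hT a (hS0 a ha) h
        _ ≤ _ := Finset.sum_le_sum_of_subset (by
            intro a ha
            rw [Finset.mem_filter] at ha
            rw [Finset.mem_erase]
            exact ⟨fun h => hts (h ▸ ha.1), ha.2⟩)
    have hlt : ∀ t ∈ T5, ∑ a ∈ T5.erase t, (3 - (a.1 + a.2)) ≤ 6 := by decide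
    have := hlt t ht
    omega
  have hc1 : (S \ T5).card = 1 := by
    rw [Finset.card_sdiff_of_subset hTS, hcard]
    rfl
  obtain ⟨g, hgS⟩ := Finset.card_eq_one.mp hc1
  have hs : ∀ F : ℕ × ℕ → ℕ, ∑ a ∈ S, F a = F g + ∑ a ∈ T5, F a := by
    intro F
    rw [← Finset.sum_sdiff hTS, hgS, Finset.sum_singleton]
  rw [hs] at h1' h2'
  have t1 : ∑ a ∈ T5, a.1 = 4 := by decide
  have t2 : ∑ a ∈ T5, a.2 = 4 := by decide
  have hgm : g ∈ S \ T5 := by rw [hgS]; simp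
  rw [Finset.mem_sdiff] at hgm
  refine ⟨g, ?_, ?_⟩
  · intro i
    have : w i ∈ S := by simp [hS]
    by_cases h5 : w i ∈ T5
    · simp only [T5, Finset.mem_insert, Finset.mem_singleton] at h5
      rcases h5 with h | h | h | h | h <;> rw [h]
      exacts [⟨0, rfl⟩, ⟨1, rfl⟩, ⟨2, rfl⟩, ⟨3, rfl⟩, ⟨4, rfl⟩]
    · have : w i ∈ S \ T5 := Finset.mem_sdiff.mpr ⟨this, h5⟩
      rw [hgS, Finset.mem_singleton] at this
      exact ⟨5, this.symm⟩
  · obtain ⟨k, l⟩ := g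
    obtain ⟨m, n⟩ := b
    have hg3 := hgm.2
    have hg0 := hS0 _ hgm.1
    rw [t1] at h1'
    rw [t2] at h2'
    simp only at h1' h2'
    have hk : k ≤ 2 := by omega
    have hl : l ≤ 2 := by omega
    obtain rfl : m = 2 - k := by omega
    obtain rfl : n = 2 - l := by omega
    exact hfin k l hk hl hg3 hg0 hb

lemma altS_fin6 (v : Fin 6 → ℕ × ℕ) (hv : Function.Injective v) (b : ℕ × ℕ) :
    altS (fun g : Fin 6 → Fin 6 => fin6 b (v ∘ g)) = 0 := by
  by_cases hall : ∀ σ : Perm (Fin 6), fin6 b (v ∘ σ) = 0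
  · unfold altS
    exact Finset.sum_eq_zero fun σ _ => by simp only [hall, smul_zero]
  · push Not at hall
    obtain ⟨σ, hσ⟩ := hall
    obtain ⟨q1, q2, q3, q4⟩ := fin6_spec _ _ hσ
    have hinj := hv.comp σ.injective
    obtain ⟨g, hg, hbg⟩ := comb _ hinj b q1 q2 q3 q4
    have hg' : ∀ i, ∃ j, can g j = v i := fun i => by
      obtain ⟨j, hj⟩ := hg (σ.symm i)
      exact ⟨j, by simpa using hj⟩
    choose ρ hρ using hg'
    have hρi : Function.Injective ρ := fun i j hij => hv (by rw [← hρ, ← hρ, hij])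
    let π : Perm (Fin 6) := Equiv.ofBijective ρ (Finite.injective_iff_bijective.mp hρi)
    have hvπ : v = can g ∘ π := by funext i; exact (hρ i).symm
    have := altS_pre (fun f : Fin 6 → Fin 6 => fin6 b (can g ∘ f)) π
    rw [hvπ]
    refine Eq.trans this ?_
    rcases hbg with ⟨rfl, rfl⟩ | ⟨rfl, rfl⟩
    · rw [check1, smul_zero]
    · rw [check2, smul_zero]

lemma core (v : Fin 6 → ℕ × ℕ) (hv : Function.Injective v) (b : ℕ × ℕ) :
    constantCoeff (sEnd (fun i => hamL (mon (v i))) (mon b)) = 0 := by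
  have h := altS_fin6 v hv b
  have h' := congrArg (fun z : ℤ => (z : ℂ)) h
  simp only [altS, Int.cast_sum, Int.cast_zero, smul_eq_mul, Int.cast_mul] at h'
  rw [sEnd_apply6, map_sum, ← h']
  refine Finset.sum_congr rfl fun σ _ => ?_
  have := cc_word (v ∘ σ) b
  simp only [Function.comp_apply] at this
  rw [map_zsmul, this, zsmul_eq_mul]

lemma monomial_eq_mon (s : Fin 2 →₀ ℕ) : (monomial s 1 : A2) = mon (s 0, s 1) := by
  rw [monomial_eq, Finsupp.prod_fintype _ _ (by simp)]
  simp [mon, Fin.prod_univ_two]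

/-- evaluation at a polynomial followed by the constant coefficient -/
noncomputable def ccEv (f : A2) : Module.End ℂ A2 →ₗ[ℂ] ℂ where
  toFun := fun T => constantCoeff (T f)
  map_add' := by intros; simp
  map_smul' := by intros; simp [smul_eq_C_mul]

lemma ccEv_apply (f : A2) (T : Module.End ℂ A2) : ccEv f T = constantCoeff (T f) := rfl

/-- the constant coefficient of `s₆` as an alternating form -/
noncomputable def ccPhi (f : A2) : A2 [⋀^Fin 6]→ₗ[ℂ] ℂ :=
  (ccEv f).compAlternatingMap (sAlt.compLinearMap hamL)

lemma ccPhi_apply (H : Fin 6 → A2) (f : A2) :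
    ccPhi f H = constantCoeff (sEnd (fun i => hamL (H i)) f) := by
  rw [← sAlt_apply, ccPhi, LinearMap.compAlternatingMap_apply,
    AlternatingMap.compLinearMap_apply, ccEv_apply]

lemma ccPhi_apply' (H : Fin 6 → A2) (T : Fin 6 → Module.End ℂ A2) (f : A2)
    (hT : ∀ i, T i = hamL (H i)) : ccPhi f H = constantCoeff (sEnd T f) := by
  obtain rfl : T = fun i => hamL (H i) := funext hT
  exact ccPhi_apply H f

lemma core' (v : Fin 6 → ℕ × ℕ) (T : Fin 6 → Module.End ℂ A2) (hT : ∀ i, T i = hamL (mon (v i)))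
    (hv : Function.Injective v) (b : ℕ × ℕ) : constantCoeff (sEnd T (mon b)) = 0 := by
  obtain rfl : T = fun i => hamL (mon (v i)) := funext hT
  exact core v hv b

lemma ccPhi_mon (b : ℕ × ℕ) : ccPhi (mon b) = 0 := by
  refine (basisMonomials (Fin 2) ℂ).ext_alternating fun v hv => ?_
  rw [ccPhi_apply' _ (fun i => hamL (mon (v i 0, v i 1))) _ (fun i => ?_),
    AlternatingMap.zero_apply]
  swap
  · simp only [coe_basisMonomials, monomial_eq_mon]
  refine core' (fun i => (v i 0, v i 1)) _ (fun i => rfl) (fun i j hij => ?_) b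
  apply hv
  simp only [Prod.mk.injEq] at hij
  refine Finsupp.ext fun k => ?_
  fin_cases k
  · exact hij.1
  · exact hij.2

/-- the constant coefficient after an operator -/
noncomputable def ccOp (T : Module.End ℂ A2) : A2 →ₗ[ℂ] ℂ where
  toFun := fun f => constantCoeff (T f)
  map_add' := by intros; simp
  map_smul' := by intros; rw [LinearMap.map_smul]; simp [smul_eq_C_mul]

lemma ccOp_apply (f : A2) (T : Module.End ℂ A2) : ccOp T f = constantCoeff (T f) := rfl

lemma cc_zero (H : Fin 6 → A2) (f : A2) :
    constantCoeff (sEnd (fun i => hamL (H i)) f) = 0 := by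
  have hΛ : ccOp (sEnd (fun i => hamL (H i))) = 0 := by
    refine (basisMonomials (Fin 2) ℂ).ext fun s => ?_
    simp only [coe_basisMonomials, monomial_eq_mon]
    rw [ccOp_apply, ← ccPhi_apply, ccPhi_mon,
      AlternatingMap.zero_apply, LinearMap.zero_apply]
  rw [← ccOp_apply, hΛ, LinearMap.zero_apply]

lemma cc_zero' (H : Fin 6 → A2) (T : Fin 6 → Module.End ℂ A2) (f : A2)
    (hT : ∀ i, T i = hamL (H i)) : constantCoeff (sEnd T f) = 0 := by
  obtain rfl : T = fun i => hamL (H i) := funext hT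
  exact cc_zero H f

lemma sEnd_ham (H : Fin 6 → A2) : sEnd (fun i => hamL (H i)) = 0 := by
  refine LinearMap.ext fun f => ?_
  refine MvPolynomial.funext fun p => ?_
  rw [← eval_trans, ← sEnd_trans, cc_zero' (fun i => trans p (H i)) _ _ (fun i => rfl)]
  rw [LinearMap.zero_apply, map_zero]

lemma sEnd_zero (X : Fin 6 → Vect 2) (hX : ∀ i, divg (X i) = 0) :
    sEnd (fun i => (X i).toLinearMap) = 0 := by
  choose H hH using fun i => exists_ham (X i) (hX i)
  rw [← sEnd_ham H]
  congr 1
  funext i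
  rw [hH i]
  rfl

end S11

/-- the Chevalley–Eilenberg coboundary of `s₅` vanishes on
divergence-free vector fields in two variables: both halves `d's₅` and `d''s₅`
are zero, so `s₅` is a 5-cocycle of the adjoint module and `(Vect₀(2), {s₂, s₅})`
is an sh-Lie algebra. -/
theorem stmt_11 (X : Fin 6 → Vect 2) (hX : ∀ i, divg (X i) = 0) :
    (∑ i : Fin 6, ∑ j : Fin 6,
      (if h : i < j then
        ((-1 : ℤ) ^ ((i : ℕ) + (j : ℕ))) •
          sEnd (Fin.cons (⁅X i, X j⁆ : Vect 2).toLinearMap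
            (fun l : Fin 4 =>
              (X (Fin.succAbove j
                (Fin.succAbove (⟨(i : ℕ), by
                  have hj := j.isLt
                  have h' : (i : ℕ) < (j : ℕ) := h
                  omega⟩ : Fin 5) l))).toLinearMap))
      else 0) = 0) ∧
    (∑ i : Fin 6,
      ((-1 : ℤ) ^ ((i : ℕ) + 1)) •
        ⁅(X i).toLinearMap,
          sEnd (fun l : Fin 5 => (X (Fin.succAbove i l)).toLinearMap)⁆ = 0) := by
  have h := S11.sEnd_zero X hX
  have hb := S11.partb (fun i => (X i).toLinearMap) h
  refine ⟨?_, by convert hb⟩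
  have ha := S11.parta (fun i => (X i).toLinearMap) h
  refine Eq.trans ?_ ha
  refine Finset.sum_congr rfl fun i _ => Finset.sum_congr rfl fun j _ => ?_
  by_cases hij : i < j
  · rw [dif_pos hij, if_pos hij]
    have : ∀ l : Fin 4, S11.restF i j l = Fin.succAbove j
        (Fin.succAbove (⟨(i : ℕ), by omega⟩ : Fin 5) l) := fun l => by
      rw [S11.restF, dif_pos hij]
    simp only [this]
    have e : (⁅X i, X j⁆ : Vect 2).toLinearMap = ⁅(X i).toLinearMap, (X j).toLinearMap⁆ :=
      Derivation.commutator_coe_linear_map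
    rw [e]
  · rw [dif_neg hij, if_neg hij]
end

section
/- There exist derivations X₁, …, X₆ ∈ Derivation ℂ A₂ A₂ such that s₆(X₁, …, X₆) ≠ 0 as a ℂ-linear endomorphism of A₂; that is, the 6-commutator s₆ is nontrivial on vector fields in two variables. -/
/-- A monomial vector field `x^p y^q ∂_i`, with `i` encoded by a boolean (`false` is `∂_x`). -/
noncomputable def monoField (v : Bool × ℕ × ℕ) : Vect 2 :=
  (MvPolynomial.X 0 ^ v.2.1 * MvPolynomial.X 1 ^ v.2.2 : MvPolynomial (Fin 2) ℂ) •
    MvPolynomial.pderiv (if v.1 then (1 : Fin 2) else 0)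

/-- The monomial `c x^a y^b`. -/
noncomputable def monoPoly (t : ℤ × ℕ × ℕ) : MvPolynomial (Fin 2) ℂ :=
  MvPolynomial.C (t.1 : ℂ) * (MvPolynomial.X 0 ^ t.2.1 * MvPolynomial.X 1 ^ t.2.2)

/-- Action of a monomial vector field on a monomial, on the level of exponents. -/
def monoStep (v : Bool × ℕ × ℕ) (t : ℤ × ℕ × ℕ) : ℤ × ℕ × ℕ :=
  if v.1 then (t.1 * (t.2.2 : ℤ), t.2.1 + v.2.1, t.2.2 - 1 + v.2.2)
  else (t.1 * (t.2.1 : ℤ), t.2.1 - 1 + v.2.1, t.2.2 + v.2.2)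

theorem monoField_monoPoly (v : Bool × ℕ × ℕ) (t : ℤ × ℕ × ℕ) :
    monoField v (monoPoly t) = monoPoly (monoStep v t) := by
  obtain ⟨i, p, q⟩ := v
  obtain ⟨c, a, b⟩ := t
  have h10 : (1 : Fin 2) ≠ 0 := by decide
  cases i <;>
    simp [monoField, monoPoly, monoStep, Derivation.leibniz, Derivation.leibniz_pow,
      MvPolynomial.pderiv_X] <;> ring

theorem prod_monoPoly (l : List (Bool × ℕ × ℕ)) (t : ℤ × ℕ × ℕ) :
    ((l.map fun v => ((monoField v).toLinearMap :
      Module.End ℂ (MvPolynomial (Fin 2) ℂ))).reverse.prod) (monoPoly t)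
      = monoPoly (l.foldl (fun t v => monoStep v t) t) := by
  induction l generalizing t with
  | nil => simp
  | cons v l ih =>
    simp only [List.map_cons, List.reverse_cons, List.prod_append, List.prod_singleton,
      Module.End.mul_apply, List.foldl_cons]
    rw [← ih, ← monoField_monoPoly]
    rfl

/-- The fields `∂x, ∂y, x∂x, x∂y, y∂x, x²∂x`. -/
def sixFields : Fin 6 → Bool × ℕ × ℕ :=
  ![(false, 0, 0), (true, 0, 0), (false, 1, 0), (true, 1, 0), (false, 0, 1), (false, 2, 0)]

theorem sixFields_sum :
    (∑ σ : Equiv.Perm (Fin 6), (Equiv.Perm.sign σ : ℤ) *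
      ((List.ofFn fun i => sixFields (σ i)).foldl
        (fun t v => monoStep v t) ((1, 0, 1) : ℤ × ℕ × ℕ)).1) = 2 := by
  decide +kernel

/-- the 6-commutator `s₆` is nontrivial on vector fields in two
variables. -/
theorem stmt_12 :
    ∃ X : Fin 6 → Vect 2, sEnd (fun i => (X i).toLinearMap) ≠ 0 := by
  refine ⟨fun i => monoField (sixFields i), fun h => ?_⟩
  have h1 := congrArg (fun T : Module.End ℂ (MvPolynomial (Fin 2) ℂ) =>
    MvPolynomial.eval (fun _ => (1 : ℂ)) (T (monoPoly (1, 0, 1)))) h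
  have key : ∀ σ : Equiv.Perm (Fin 6),
      (List.ofFn fun i : Fin 6 => ((monoField (sixFields (σ i))).toLinearMap :
        Module.End ℂ (MvPolynomial (Fin 2) ℂ))).reverse.prod (monoPoly (1, 0, 1))
      = monoPoly ((List.ofFn fun i => sixFields (σ i)).foldl
        (fun t v => monoStep v t) ((1, 0, 1) : ℤ × ℕ × ℕ)) := by
    intro σ
    rw [← prod_monoPoly, List.map_ofFn]
    rfl
  have ev : ∀ t, MvPolynomial.eval (fun _ => (1 : ℂ)) (monoPoly t) = (t.1 : ℂ) := by
    intro t
    simp [monoPoly]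
  simp only [sEnd, LinearMap.sum_apply, LinearMap.smul_apply, key, map_sum, map_zsmul, ev,
    LinearMap.zero_apply, map_zero] at h1
  simp only [zsmul_eq_mul] at h1
  have h2 := congrArg (Int.cast : ℤ → ℂ) sixFields_sum
  push_cast at h2
  rw [h1] at h2
  norm_num at h2
end

section
/- For all derivations X₁, …, X₆ ∈ Derivation ℂ A₂ A₂, the ℂ-linear endomorphism s₆(X₁, …, X₆) of A₂ equals the endomorphism underlying the derivation s₆^{rsym}(X₁, …, X₆); in particular, s₆(X₁, …, X₆) is itself a derivation of A₂, i.e. s₆ is a well-defined 6-commutator on vector fields in two variables. -/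
namespace SixComm

open TensorProduct

section Core

variable {B : Type*} [Ring B]

/-- Coefficient identities in an algebra with anticommuting elements. -/
lemma odd_identities (w : Fin 12 → B) (hs : ∀ i, w i * w i = 0)
    (hw : ∀ i j, w i * w j = -(w j * w i)) (a b a0 a1 b0 b1 : B)
    (ha : a = w 0 * w 2 + w 1 * w 3) (hb : b = w 0 * w 4 + w 1 * w 5)
    (ha0 : a0 = w 2 * w 2 + w 0 * w 6 + (w 4 * w 3 + w 1 * w 7))
    (ha1 : a1 = w 3 * w 2 + w 0 * w 7 + (w 5 * w 3 + w 1 * w 8))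
    (hb0 : b0 = w 2 * w 4 + w 0 * w 9 + (w 4 * w 5 + w 1 * w 10))
    (hb1 : b1 = w 3 * w 4 + w 0 * w 10 + (w 5 * w 5 + w 1 * w 11)) :
    a * a * a = 0 ∧ a * a * b = 0 ∧ a * b * b = 0 ∧ b * b * b = 0 ∧
    a * (a * a0 + b * a1) = 0 ∧ b * (a * b0 + b * b1) = 0 ∧
    b * (a * a0 + b * a1) + a * (a * b0 + b * b1) = 0 := by
  have h1 : ∀ i j, i < j → w j * w i = -(w i * w j) := fun i j _ => hw j i
  have h2 : ∀ i j, i < j → ∀ x, w j * (w i * x) = -(w i * (w j * x)) := fun i j _ x => by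
    rw [← mul_assoc, hw j i, neg_mul, mul_assoc]
  have h3 : ∀ i x, w i * (w i * x) = 0 := fun i x => by rw [← mul_assoc, hs, zero_mul]
  subst ha hb ha0 ha1 hb0 hb1
  refine ⟨?_, ?_, ?_, ?_, ?_, ?_, ?_⟩ <;>
    simp [mul_add, add_mul, mul_assoc, h1, h2, h3, hs] <;> try abel

lemma cross_terms {C : Type*} [CommRing C] [Algebra C B] (a b c e : C)
    (F0 F1 F00 F01 F11 G0 G1 G00 G01 G11 : B)
    (h1 : a * a * a = 0) (h2 : a * a * b = 0) (h3 : a * b * b = 0) (h4 : b * b * b = 0)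
    (h5 : a * c = 0) (h6 : b * e = 0) (h7 : b * c + a * e = 0) :
    (c • F0 + e • F1 + (a * a) • F00 + (2 * a * b) • F01 + (b * b) • F11) * (a • G0 + b • G1) +
    (a • F0 + b • F1) *
      (c • G0 + e • G1 + (a * a) • G00 + (2 * a * b) • G01 + (b * b) • G11) = 0 := by
  simp only [mul_add, add_mul, smul_mul_smul_comm]
  linear_combination (norm := module) h5 • (F0 * G0) + h5 • (F0 * G0) + h6 • (F1 * G1) + h6 • (F1 * G1)
    + h7 • (F0 * G1) + h7 • (F1 * G0)
    + h1 • (F00 * G0) + h2 • (F00 * G1) + (2 * h2) • (F01 * G0) + (2 * h3) • (F01 * G1)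
    + h3 • (F11 * G0) + h4 • (F11 * G1)
    + h1 • (F0 * G00) + h2 • (F1 * G00) + (2 * h2) • (F0 * G01) + (2 * h3) • (F1 * G01)
    + h3 • (F0 * G11) + h4 • (F1 * G11)

/-- If `E` is a derivation-like map with vanishing cross terms, then `E³` is too. -/
lemma cube_leibniz (E : B →+ B) (hE : ∀ x y, E (x * y) = E x * y + x * E y)
    (hc : ∀ x y, E (E x) * E y + E x * E (E y) = 0) (x y : B) :
    E (E (E (x * y))) = E (E (E x)) * y + x * E (E (E y)) := by
  simp only [hE, map_add]
  have := hc x y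
  linear_combination (norm := module) (3 : ℤ) • this

lemma core (d0 d1 : B →+ B) (hd0 : ∀ x y, d0 (x * y) = d0 x * y + x * d0 y)
    (hd1 : ∀ x y, d1 (x * y) = d1 x * y + x * d1 y) (hdd : ∀ x, d1 (d0 x) = d0 (d1 x))
    (O : Set B) (hs : ∀ x ∈ O, x * x = 0) (hw : ∀ x ∈ O, ∀ y ∈ O, x * y = -(y * x))
    (hO0 : ∀ x ∈ O, d0 x ∈ O) (hO1 : ∀ x ∈ O, d1 x ∈ O)
    (hcen : ∀ x ∈ O, ∀ y ∈ O, ∀ z, x * y * z = z * (x * y))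
    (u v : B) (hu : u ∈ O) (hv : v ∈ O) (D : B → B) (hD : ∀ x, D x = u * d0 x + v * d1 x)
    (x y : B) :
    D^[6] (x * y) = D^[6] x * y + x * D^[6] y := by
  have cenO : ∀ x ∈ O, ∀ y ∈ O, x * y ∈ Subring.center B := fun x hx y hy =>
    Subring.mem_center_iff.2 fun z => (hcen x hx y hy z).symm
  obtain ⟨a, ha⟩ : ∃ a : Subring.center B, (a : B) = u * d0 u + v * d1 u :=
    ⟨⟨_, add_mem (cenO _ hu _ (hO0 _ hu)) (cenO _ hv _ (hO1 _ hu))⟩, rfl⟩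
  obtain ⟨b, hb⟩ : ∃ b : Subring.center B, (b : B) = u * d0 v + v * d1 v :=
    ⟨⟨_, add_mem (cenO _ hu _ (hO0 _ hv)) (cenO _ hv _ (hO1 _ hv))⟩, rfl⟩
  have h0 : ∀ p ∈ O, ∀ q ∈ O, d0 (p * q) ∈ Subring.center B := fun p hp q hq => by
    rw [hd0]; exact add_mem (cenO _ (hO0 _ hp) _ hq) (cenO _ hp _ (hO0 _ hq))
  have h1 : ∀ p ∈ O, ∀ q ∈ O, d1 (p * q) ∈ Subring.center B := fun p hp q hq => by
    rw [hd1]; exact add_mem (cenO _ (hO1 _ hp) _ hq) (cenO _ hp _ (hO1 _ hq))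
  obtain ⟨a0, ha0⟩ : ∃ c : Subring.center B, (c : B) = d0 a :=
    ⟨⟨_, by rw [ha, map_add]; exact add_mem (h0 _ hu _ (hO0 _ hu)) (h0 _ hv _ (hO1 _ hu))⟩, rfl⟩
  obtain ⟨a1, ha1⟩ : ∃ c : Subring.center B, (c : B) = d1 a :=
    ⟨⟨_, by rw [ha, map_add]; exact add_mem (h1 _ hu _ (hO0 _ hu)) (h1 _ hv _ (hO1 _ hu))⟩, rfl⟩
  obtain ⟨b0, hb0⟩ : ∃ c : Subring.center B, (c : B) = d0 b :=
    ⟨⟨_, by rw [hb, map_add]; exact add_mem (h0 _ hu _ (hO0 _ hv)) (h0 _ hv _ (hO1 _ hv))⟩, rfl⟩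
  obtain ⟨b1, hb1⟩ : ∃ c : Subring.center B, (c : B) = d1 b :=
    ⟨⟨_, by rw [hb, map_add]; exact add_mem (h1 _ hu _ (hO0 _ hv)) (h1 _ hv _ (hO1 _ hv))⟩, rfl⟩
  -- the even derivation
  let E : B →+ B := (AddMonoidHom.mulLeft (a : B)).comp d0 + (AddMonoidHom.mulLeft (b : B)).comp d1
  have hEa : ∀ x, E x = a * d0 x + b * d1 x := fun x => rfl
  have hEs : ∀ x, E x = a • d0 x + b • d1 x := fun x => rfl
  have hDD : ∀ x, D (D x) = E x := fun x => by
    have e1 := hs u hu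
    have e2 := hs v hv
    have e3 := hw v hv u hu
    rw [hD (D x), hD x, hEa, ha, hb]
    simp only [map_add, hd0, hd1, hdd, mul_add, add_mul, ← mul_assoc, e1, e2, e3]
    noncomm_ring
  have hD6 : ∀ x, D^[6] x = E (E (E x)) := fun x => by
    simp only [← hDD]; rfl
  rw [hD6, hD6, hD6]
  have hca : ∀ z, (a : B) * z = z * a := fun z => (Subring.mem_center_iff.1 a.2 z).symm
  have hcb : ∀ z, (b : B) * z = z * b := fun z => (Subring.mem_center_iff.1 b.2 z).symm
  apply cube_leibniz
  · intro x y
    simp only [hEa, hd0, hd1, mul_add, add_mul, ← mul_assoc, ← hca x, ← hcb x]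
    abel
  · intro x y
    have hE2 : ∀ x, E (E x) = (a * a0 + b * a1) • d0 x + (a * b0 + b * b1) • d1 x
        + (a * a) • d0 (d0 x) + (2 * a * b) • d0 (d1 x) + (b * b) • d1 (d1 x) := fun x => by
      have e : ∀ (c : Subring.center B) (z : B), (c : B) * z = c • z := fun _ _ => rfl
      have k0 : ∀ (c : Subring.center B) (z : B), d0 (c • z) = d0 c * z + c • d0 z :=
        fun c z => hd0 c z
      have k1 : ∀ (c : Subring.center B) (z : B), d1 (c • z) = d1 c * z + c • d1 z :=
        fun c z => hd1 c z
      rw [hEs (E x), hEs x]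
      simp only [map_add, k0, k1, ← ha0, ← ha1, ← hb0, ← hb1, e, hdd]
      module
    rw [hE2, hE2, hEs, hEs]
    obtain ⟨i1, i2, i3, i4, i5, i6, i7⟩ := odd_identities
      ![u, v, d0 u, d1 u, d0 v, d1 v, d0 (d0 u), d0 (d1 u), d1 (d1 u),
        d0 (d0 v), d0 (d1 v), d1 (d1 v)]
      (fun i => hs _ (by fin_cases i <;> simp [hO0, hO1, hu, hv]))
      (fun i j => hw _ (by fin_cases i <;> simp [hO0, hO1, hu, hv])
        _ (by fin_cases j <;> simp [hO0, hO1, hu, hv]))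
      a b a0 a1 b0 b1 ha hb
      (by rw [ha0, ha, map_add, hd0, hd0]; rfl)
      (by rw [ha1, ha, map_add, hd1, hd1, hdd]; rfl)
      (by rw [hb0, hb, map_add, hd0, hd0]; rfl)
      (by rw [hb1, hb, map_add, hd1, hd1, hdd]; rfl)
    apply cross_terms <;> apply Subtype.ext <;> push_cast <;> assumption

end Core

section Model

abbrev A2 := MvPolynomial (Fin 2) ℂ
abbrev Lam := ExteriorAlgebra ℂ (Fin 6 → ℂ)
abbrev BB := A2 ⊗[ℂ] Lam

/-- Odd generators. -/
noncomputable def xi (i : Fin 6) : Lam := ExteriorAlgebra.ι ℂ (Pi.single i 1)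

lemma xi_anti (i j : Fin 6) : xi i * xi j = -(xi j * xi i) :=
  eq_neg_of_add_eq_zero_left (ExteriorAlgebra.ι_add_mul_swap _ _)

/-- Odd elements of degree one. -/
noncomputable def theta (p : Fin 6 → A2) : BB := ∑ i, p i ⊗ₜ xi i

lemma theta_anti (p q : Fin 6 → A2) : theta p * theta q = -(theta q * theta p) := by
  simp only [theta, Finset.sum_mul_sum, Algebra.TensorProduct.tmul_mul_tmul]
  rw [Finset.sum_comm, ← Finset.sum_neg_distrib]
  refine Finset.sum_congr rfl fun i _ => ?_
  rw [← Finset.sum_neg_distrib]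
  refine Finset.sum_congr rfl fun j _ => ?_
  rw [xi_anti, mul_comm, TensorProduct.tmul_neg]

lemma theta_sq (p : Fin 6 → A2) : theta p * theta p = 0 := by
  have h := theta_anti p p
  have h2 : (2 : ℂ) • (theta p * theta p) = 0 := by
    rw [two_smul]; nth_rewrite 1 [h]; exact neg_add_cancel _
  exact (smul_eq_zero.1 h2).resolve_left two_ne_zero

lemma xi_xi_central (i j : Fin 6) (z : Lam) : xi i * xi j * z = z * (xi i * xi j) := by
  have key : ∀ m : Fin 6 → ℂ, ∀ i, xi i * ExteriorAlgebra.ι ℂ m = -(ExteriorAlgebra.ι ℂ m * xi i) :=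
    fun m i => eq_neg_of_add_eq_zero_left (ExteriorAlgebra.ι_add_mul_swap _ _)
  induction z using ExteriorAlgebra.induction with
  | algebraMap r => exact (Algebra.commutes r _).symm
  | ι m => rw [mul_assoc, key m j, mul_neg, ← mul_assoc, key m i, neg_mul, neg_neg, mul_assoc]
  | mul x y hx hy => rw [← mul_assoc, hx, mul_assoc, hy, mul_assoc]
  | add x y hx hy => rw [mul_add, add_mul, hx, hy]

lemma theta_central (p q : Fin 6 → A2) (z : BB) :
    theta p * theta q * z = z * (theta p * theta q) := by
  simp only [theta, Finset.sum_mul_sum, Algebra.TensorProduct.tmul_mul_tmul, Finset.sum_mul,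
    Finset.mul_sum]
  refine Finset.sum_congr rfl fun i _ => Finset.sum_congr rfl fun j _ => ?_
  induction z using TensorProduct.induction_on with
  | zero => simp
  | tmul f l => rw [Algebra.TensorProduct.tmul_mul_tmul, Algebra.TensorProduct.tmul_mul_tmul,
      xi_xi_central, mul_comm]
  | add x y hx hy => rw [mul_add, add_mul, hx, hy]

/-- Coefficientwise partial derivative. -/
noncomputable def dd (k : Fin 2) : BB →ₗ[ℂ] BB :=
  LinearMap.rTensor Lam (MvPolynomial.pderiv k : Vect 2).toLinearMap

lemma dd_tmul (k : Fin 2) (f : A2) (l : Lam) :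
    dd k (f ⊗ₜ l) = MvPolynomial.pderiv k f ⊗ₜ l := rfl

lemma dd_mul (k : Fin 2) (x y : BB) : dd k (x * y) = dd k x * y + x * dd k y := by
  induction x using TensorProduct.induction_on with
  | zero => simp
  | add x x' hx hx' => simp only [add_mul, map_add, hx, hx']; abel
  | tmul f l =>
    induction y using TensorProduct.induction_on with
    | zero => simp
    | add y y' hy hy' => simp only [mul_add, map_add, hy, hy']; abel
    | tmul g m =>
      simp only [dd_tmul, Algebra.TensorProduct.tmul_mul_tmul, Derivation.leibniz, smul_eq_mul,
        TensorProduct.add_tmul]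
      rw [add_comm, mul_comm g]

lemma dd_comm (x : BB) : dd 1 (dd 0 x) = dd 0 (dd 1 x) := by
  induction x using TensorProduct.induction_on with
  | zero => simp
  | add x x' hx hx' => simp only [map_add, hx, hx']
  | tmul f l =>
    simp only [dd_tmul]
    have : ⁅(MvPolynomial.pderiv 1 : Vect 2), (MvPolynomial.pderiv 0 : Vect 2)⁆ = 0 := by
      apply MvPolynomial.derivation_ext
      intro i
      simp [Derivation.commutator_apply, MvPolynomial.pderiv_X, Pi.single_apply]
      fin_cases i <;> simp
    have h := congrArg (fun D : Vect 2 => D f) this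
    have h' : MvPolynomial.pderiv 1 (MvPolynomial.pderiv 0 f) =
        MvPolynomial.pderiv 0 (MvPolynomial.pderiv 1 f) := by
      simpa [Derivation.commutator_apply, sub_eq_zero] using h
    rw [h']

lemma dd_theta (k : Fin 2) (p : Fin 6 → A2) :
    dd k (theta p) = theta fun i => MvPolynomial.pderiv k (p i) := by
  simp [theta, dd_tmul]

/-- The odd vector field. -/
noncomputable def DD (X : Fin 6 → Vect 2) : BB →ₗ[ℂ] BB :=
  ∑ i, TensorProduct.map (X i).toLinearMap (LinearMap.mulLeft ℂ (xi i))

lemma DD_tmul (X : Fin 6 → Vect 2) (f : A2) (l : Lam) :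
    DD X (f ⊗ₜ l) = ∑ i, X i f ⊗ₜ (xi i * l) := by
  simp [DD]

lemma vect_apply (X : Vect 2) (f : A2) :
    X f = X (MvPolynomial.X 0) * MvPolynomial.pderiv 0 f
      + X (MvPolynomial.X 1) * MvPolynomial.pderiv 1 f := by
  have : X = X (MvPolynomial.X 0) • (MvPolynomial.pderiv 0 : Vect 2)
      + X (MvPolynomial.X 1) • (MvPolynomial.pderiv 1 : Vect 2) := by
    apply MvPolynomial.derivation_ext
    intro i
    fin_cases i <;> simp [MvPolynomial.pderiv_X]
  exact congrArg (fun D : Vect 2 => D f) this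

lemma DD_eq (X : Fin 6 → Vect 2) (x : BB) :
    DD X x = theta (fun i => X i (MvPolynomial.X 0)) * dd 0 x
      + theta (fun i => X i (MvPolynomial.X 1)) * dd 1 x := by
  induction x using TensorProduct.induction_on with
  | zero => simp
  | add x x' hx hx' => simp only [map_add, hx, hx', mul_add]; abel
  | tmul f l =>
    simp only [DD_tmul, theta, dd_tmul, Finset.sum_mul, Algebra.TensorProduct.tmul_mul_tmul]
    rw [← Finset.sum_add_distrib]
    refine Finset.sum_congr rfl fun i _ => ?_
    rw [vect_apply (X i) f, TensorProduct.add_tmul]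

lemma DD_six (X : Fin 6 → Vect 2) (x y : BB) :
    (DD X)^[6] (x * y) = (DD X)^[6] x * y + x * (DD X)^[6] y := by
  refine core (dd 0).toAddMonoidHom (dd 1).toAddMonoidHom (dd_mul 0) (dd_mul 1) dd_comm
    (Set.range theta) ?_ ?_ ?_ ?_ ?_ _ _ ⟨_, rfl⟩ ⟨_, rfl⟩ (DD X) (DD_eq X) x y
  · rintro _ ⟨p, rfl⟩; exact theta_sq p
  · rintro _ ⟨p, rfl⟩ _ ⟨q, rfl⟩; exact theta_anti p q
  · rintro _ ⟨p, rfl⟩; exact ⟨_, (dd_theta 0 p).symm⟩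
  · rintro _ ⟨p, rfl⟩; exact ⟨_, (dd_theta 1 p).symm⟩
  · rintro _ ⟨p, rfl⟩ _ ⟨q, rfl⟩ z; exact theta_central p q z

lemma DD_iter (X : Fin 6 → Vect 2) (n : ℕ) (f : A2) (l : Lam) :
    (DD X)^[n] (f ⊗ₜ l) = ∑ g : Fin n → Fin 6,
      ((List.ofFn fun i => (X (g i)).toLinearMap).reverse.prod : Module.End ℂ A2) f ⊗ₜ
        ((List.ofFn fun i => xi (g i)).reverse.prod * l) := by
  induction n generalizing f l with
  | zero => simp
  | succ n ih =>
    have hsum : ∀ (s : Finset (Fin 6)) (t : Fin 6 → BB),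
        (DD X)^[n] (∑ i ∈ s, t i) = ∑ i ∈ s, (DD X)^[n] (t i) := fun s t => by
      rw [← Module.End.coe_pow]; exact map_sum _ _ _
    rw [Function.iterate_succ_apply, DD_tmul, hsum]
    simp only [ih]
    rw [← (Fin.consEquiv fun _ : Fin (n + 1) => Fin 6).sum_comp, Fintype.sum_prod_type]
    refine Finset.sum_congr rfl fun i _ => Finset.sum_congr rfl fun g _ => ?_
    simp [Fin.consEquiv, List.ofFn_succ, mul_assoc]

/-- The functional extracting the top coefficient. -/
noncomputable def phi : Lam →ₗ[ℂ] ℂ :=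
  ExteriorAlgebra.liftAlternating (Function.update (β := fun n => (Fin 6 → ℂ) [⋀^Fin n]→ₗ[ℂ] ℂ) 0 6
    ((Matrix.detRowAlternating (n := Fin 6) (R := ℂ)).domDomCongr Fin.revPerm))

lemma phi_xi (g : Fin 6 → Fin 6) :
    phi (List.ofFn fun i => xi (g i)).reverse.prod =
      Matrix.det (Matrix.of fun i => (Pi.single (g i) 1 : Fin 6 → ℂ)) := by
  have : (List.ofFn fun i => xi (g i)).reverse.prod =
      ExteriorAlgebra.ιMulti ℂ 6 (fun i => (Pi.single (g i.rev) 1 : Fin 6 → ℂ)) := by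
    rw [ExteriorAlgebra.ιMulti_apply]
    simp [List.ofFn_succ, xi, mul_assoc]
  rw [this, phi, ExteriorAlgebra.liftAlternating_apply_ιMulti, Function.update_self,
    AlternatingMap.domDomCongr_apply]
  have e : (fun i : Fin 6 => (Pi.single (g (Fin.rev (Fin.revPerm i))) 1 : Fin 6 → ℂ)) =
      Matrix.of fun i => (Pi.single (g i) 1 : Fin 6 → ℂ) := by
    funext i; simp; rfl
  exact congrArg Matrix.det e

/-- Extraction of the top coefficient. -/
noncomputable def Phi : BB →ₗ[ℂ] A2 :=
  (TensorProduct.rid ℂ A2).toLinearMap ∘ₗ LinearMap.lTensor A2 phi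

lemma Phi_tmul (f : A2) (l : Lam) : Phi (f ⊗ₜ l) = phi l • f := by
  simp [Phi]

lemma Phi_mul (f : A2) (y : BB) : Phi ((f ⊗ₜ 1) * y) = f * Phi y := by
  induction y using TensorProduct.induction_on with
  | zero => simp
  | add x x' hx hx' => simp only [map_add, hx, hx', mul_add]
  | tmul g l => simp [Phi_tmul, Algebra.TensorProduct.tmul_mul_tmul]

lemma Phi_mul' (f : A2) (y : BB) : Phi (y * (f ⊗ₜ 1)) = f * Phi y := by
  induction y using TensorProduct.induction_on with
  | zero => simp
  | add x x' hx hx' => simp only [map_add, hx, hx', mul_add, add_mul]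
  | tmul g l => simp [Phi_tmul, Algebra.TensorProduct.tmul_mul_tmul, mul_comm]

lemma det_single (g : Fin 6 → Fin 6) :
    Matrix.det (Matrix.of fun i => (Pi.single (g i) 1 : Fin 6 → ℂ)) =
      ∑ σ : Equiv.Perm (Fin 6), if g = σ then ((Equiv.Perm.sign σ : ℤ) : ℂ) else 0 := by
  rw [← Matrix.det_transpose, Matrix.det_apply']
  refine Finset.sum_congr rfl fun σ _ => ?_
  split_ifs with h
  · subst h; simp
  · obtain ⟨i, hi⟩ := Function.ne_iff.1 h
    rw [Finset.prod_eq_zero (Finset.mem_univ i), mul_zero]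
    simp [Pi.single_apply, Ne.symm hi]

lemma Phi_DD (X : Fin 6 → Vect 2) (f : A2) :
    Phi ((DD X)^[6] (f ⊗ₜ 1)) = sEnd (fun i => (X i).toLinearMap) f := by
  rw [DD_iter, map_sum]
  simp only [Phi_tmul, mul_one, phi_xi, det_single, Finset.sum_smul]
  rw [Finset.sum_comm, sEnd, LinearMap.sum_apply]
  refine Finset.sum_congr rfl fun σ _ => ?_
  simp only [ite_smul, zero_smul]
  rw [Finset.sum_ite_eq' Finset.univ (σ : Fin 6 → Fin 6)]
  simp only [Finset.mem_univ, if_true, LinearMap.smul_apply]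
  exact Int.cast_smul_eq_zsmul ℂ _ _

lemma sEnd_leibniz (X : Fin 6 → Vect 2) (f g : A2) :
    sEnd (fun i => (X i).toLinearMap) (f * g) =
      f • sEnd (fun i => (X i).toLinearMap) g + g • sEnd (fun i => (X i).toLinearMap) f := by
  have h : ((f * g) ⊗ₜ 1 : BB) = (f ⊗ₜ 1) * (g ⊗ₜ 1) := by simp
  rw [← Phi_DD, ← Phi_DD, ← Phi_DD, h, DD_six, map_add, Phi_mul, Phi_mul', smul_eq_mul,
    smul_eq_mul, add_comm]

lemma foldl_rsym (l : List (Vect 2)) (a : Vect 2) (i : Fin 2) :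
    l.foldl rsym a (MvPolynomial.X i) =
      ((l.map fun Y => (Y.toLinearMap : Module.End ℂ A2)).reverse.prod)
        (a (MvPolynomial.X i)) := by
  induction l generalizing a with
  | nil => simp
  | cons b l ih => simp [ih, rsym, MvPolynomial.mkDerivation_X]

lemma leftNormProd_apply (X : Fin 6 → Vect 2) (i : Fin 2) :
    leftNormProd (List.ofFn X) (MvPolynomial.X i) =
      ((List.ofFn fun j => ((X j).toLinearMap : Module.End ℂ A2)).reverse.prod)
        (MvPolynomial.X i) := by
  rw [List.ofFn_succ, leftNormProd, foldl_rsym, List.ofFn_succ (n := 5), List.map_ofFn]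
  simp only [List.reverse_cons, List.prod_append, List.prod_singleton, Module.End.mul_apply]
  rfl

lemma ext_aux (T : Module.End ℂ A2) (hT : ∀ f g, T (f * g) = f • T g + g • T f) (Y : Vect 2)
    (h : ∀ i, T (MvPolynomial.X i) = Y (MvPolynomial.X i)) : T = Y.toLinearMap := by
  have h : Derivation.mk' T hT = Y := MvPolynomial.derivation_ext h
  rw [← h]
  rfl

end Model

end SixComm

/-- `s₆ = s₆^{rsym}` on vector fields in two variables; in
particular `s₆` is a well-defined 6-commutator on `Vect(2)`. -/
theorem stmt_13 (X : Fin 6 → Vect 2) :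
    sEnd (fun i => (X i).toLinearMap) = (sRsym X).toLinearMap := by
  apply SixComm.ext_aux _ (SixComm.sEnd_leibniz X)
  intro i
  rw [sEnd, sRsym, LinearMap.sum_apply]
  have hs : ∀ (F : Equiv.Perm (Fin 6) → Vect 2) (f : MvPolynomial (Fin 2) ℂ),
      (∑ σ, F σ) f = ∑ σ, F σ f := fun F f => by
    have := map_sum (Derivation.coeFnAddMonoidHom (R := ℂ) (A := MvPolynomial (Fin 2) ℂ)
      (M := MvPolynomial (Fin 2) ℂ)) F Finset.univ
    exact (congrFun this f).trans (Finset.sum_apply _ _ _)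
  rw [hs]
  refine Finset.sum_congr rfl fun σ _ => ?_
  rw [LinearMap.smul_apply, Derivation.smul_apply,
    SixComm.leftNormProd_apply (fun j => X (σ j)) i]
end

section
/- For all derivations X₁, …, X₇ ∈ Derivation ℂ A₂ A₂ one has s₇(X₁, …, X₇) = 0 as a ℂ-linear endomorphism of A₂; that is, s₇ = 0 is an identity on vector fields in two variables. -/
set_option linter.unusedSimpArgs false
set_option maxHeartbeats 4000000 in
theorem odd_core {B : Type*} [Ring B] (d1 d2 : B →+ B) (w : ℕ → B)
    (L1 : ∀ x y, d1 (x * y) = d1 x * y + x * d1 y)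
    (L2 : ∀ x y, d2 (x * y) = d2 x * y + x * d2 y)
    (hc : ∀ x, d2 (d1 x) = d1 (d2 x))
    (hs : ∀ i, w i * w i = 0) (ha : ∀ i j, j < i → w i * w j = -(w j * w i))
    (a0 : d1 (w 0) = w 2) (b0 : d2 (w 0) = w 3)
    (a1 : d1 (w 1) = w 4) (b1 : d2 (w 1) = w 5)
    (a2 : d1 (w 2) = w 6) (b2 : d2 (w 2) = w 7)
    (a3 : d1 (w 3) = w 7) (b3 : d2 (w 3) = w 8)
    (a4 : d1 (w 4) = w 9) (b4 : d2 (w 4) = w 10)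
    (a5 : d1 (w 5) = w 10) (b5 : d2 (w 5) = w 11)
    (a6 : d1 (w 6) = w 12) (b6 : d2 (w 6) = w 13)
    (a7 : d1 (w 7) = w 13) (b7 : d2 (w 7) = w 14)
    (a8 : d1 (w 8) = w 14) (b8 : d2 (w 8) = w 15)
    (a9 : d1 (w 9) = w 16) (b9 : d2 (w 9) = w 17)
    (a10 : d1 (w 10) = w 17) (b10 : d2 (w 10) = w 18)
    (a11 : d1 (w 11) = w 18) (b11 : d2 (w 11) = w 19)
    (D : B → B) (hD : ∀ x, D x = w 0 * d1 x + w 1 * d2 x) (F : B) :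
    D (D (D (D (D (D (D F)))))) = 0 := by
  have hs' : ∀ i c, w i * (w i * c) = 0 := fun i c => by rw [← mul_assoc, hs, zero_mul]
  have ha' : ∀ i j, j < i → ∀ c, w i * (w j * c) = -(w j * (w i * c)) := fun i j h c => by
    rw [← mul_assoc, ha i j h, neg_mul, mul_assoc]
  have hE : ∀ x, D (D x) = (w 0 * w 2 + w 1 * w 3) * d1 x + (w 0 * w 4 + w 1 * w 5) * d2 x := by
    intro x
    simp only [map_add, map_neg, map_sub, map_zero, mul_neg, neg_mul, sub_eq_add_neg, neg_add_rev, neg_neg, neg_zero, mul_zero, zero_mul, add_zero, zero_add, Nat.reduceLT, Nat.ofNat_pos, Nat.one_lt_ofNat, Nat.zero_lt_one, hD, L1, L2, hc, a0, a1, b0, b1, mul_add, add_mul, mul_assoc, hs, ha, hs', ha']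
    abel
  generalize hp : (w 0 * w 2 + w 1 * w 3) * d1 (w 0 * w 2 + w 1 * w 3) +
      (w 0 * w 4 + w 1 * w 5) * d2 (w 0 * w 2 + w 1 * w 3) = p
  generalize hq : (w 0 * w 2 + w 1 * w 3) * d1 (w 0 * w 4 + w 1 * w 5) +
      (w 0 * w 4 + w 1 * w 5) * d2 (w 0 * w 4 + w 1 * w 5) = q
  simp only [map_add, map_neg, map_sub, map_zero, mul_neg, neg_mul, sub_eq_add_neg, neg_add_rev, neg_neg, neg_zero, mul_zero, zero_mul, add_zero, zero_add, Nat.reduceLT, Nat.ofNat_pos, Nat.one_lt_ofNat, Nat.zero_lt_one, L1, L2, a0, a1, a2, a3, a4, a5, b0, b1, b2, b3, b4, b5, mul_add, add_mul, mul_assoc, hs, ha, hs', ha'] at hp hq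
  have hEE : ∀ x, D (D (D (D x))) = p * d1 x + q * d2 x
      - ((w 0 * (w 1 * (w 2 * (w 3 * d1 (d1 x))))) + (w 0 * (w 1 * (w 2 * (w 3 * d1 (d1 x))))))
      + ((w 0 * (w 1 * (w 3 * (w 4 * d1 (d2 x))))) + (w 0 * (w 1 * (w 3 * (w 4 * d1 (d2 x))))))
      - ((w 0 * (w 1 * (w 2 * (w 5 * d1 (d2 x))))) + (w 0 * (w 1 * (w 2 * (w 5 * d1 (d2 x))))))
      - ((w 0 * (w 1 * (w 4 * (w 5 * d2 (d2 x))))) + (w 0 * (w 1 * (w 4 * (w 5 * d2 (d2 x)))))) := by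
    intro x
    rw [hE, hE, ← hp, ← hq]
    simp only [map_add, map_neg, map_sub, map_zero, mul_neg, neg_mul, sub_eq_add_neg, neg_add_rev, neg_neg, neg_zero, mul_zero, zero_mul, add_zero, zero_add, Nat.reduceLT, Nat.ofNat_pos, Nat.one_lt_ofNat, Nat.zero_lt_one, L1, L2, hc, a0, a1, a2, a3, a4, a5, b0, b1, b2, b3, b4, b5, mul_add, add_mul, mul_assoc, hs, ha, hs', ha']
    abel
  generalize hP : (w 0 * w 2 + w 1 * w 3) * d1 p + (w 0 * w 4 + w 1 * w 5) * d2 p = P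
  generalize hQ : (w 0 * w 2 + w 1 * w 3) * d1 q + (w 0 * w 4 + w 1 * w 5) * d2 q = Q
  have hEEE : ∀ x, D (D (D (D (D (D x))))) = P * d1 x + Q * d2 x := by
    intro x
    rw [hE, hEE, ← hP, ← hQ, ← hp, ← hq]
    simp only [map_add, map_neg, map_sub, map_zero, mul_neg, neg_mul, sub_eq_add_neg, neg_add_rev, neg_neg, neg_zero, mul_zero, zero_mul, add_zero, zero_add, Nat.reduceLT, Nat.ofNat_pos, Nat.one_lt_ofNat, Nat.zero_lt_one, L1, L2, hc, a0, a1, a2, a3, a4, a5, b0, b1, b2, b3, b4, b5, mul_add, add_mul, mul_assoc, hs, ha, hs', ha']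
    abel
  rw [← hp] at hP
  rw [← hq] at hQ
  simp only [map_add, map_neg, map_sub, map_zero, mul_neg, neg_mul, sub_eq_add_neg, neg_add_rev, neg_neg, neg_zero, mul_zero, zero_mul, add_zero, zero_add, Nat.reduceLT, Nat.ofNat_pos, Nat.one_lt_ofNat, Nat.zero_lt_one, L1, L2, a0, a1, a2, a3, a4, a5, a6, a7, a8, a9, a10, a11, b0, b1, b2, b3, b4, b5, b6, b7, b8, b9, b10, b11, mul_add, add_mul, mul_assoc, hs, ha, hs', ha'] at hP hQ
  rw [hEEE, hD, ← hP, ← hQ]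
  simp only [map_add, map_neg, map_sub, map_zero, mul_neg, neg_mul, sub_eq_add_neg, neg_add_rev, neg_neg, neg_zero, mul_zero, zero_mul, add_zero, zero_add, Nat.reduceLT, Nat.ofNat_pos, Nat.one_lt_ofNat, Nat.zero_lt_one, L1, L2, hc, a0, a1, b0, b1, mul_add, add_mul, mul_assoc, hs, ha, hs', ha']
  abel

open scoped TensorProduct

noncomputable section

abbrev GA : Type := MvPolynomial (Fin 2) ℂ

section generic

variable {Λ : Type} [Ring Λ] [Algebra ℂ Λ]

/-- coefficientwise action of an endomorphism of the polynomial ring -/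
def gExt (T : GA →ₗ[ℂ] GA) : (GA ⊗[ℂ] Λ) →ₗ[ℂ] (GA ⊗[ℂ] Λ) := T.rTensor Λ

theorem gExt_leibniz (T : Vect 2) (x y : (GA ⊗[ℂ] Λ)) :
    gExt T.toLinearMap (x * y) = gExt T.toLinearMap x * y + x * gExt T.toLinearMap y := by
  induction x using TensorProduct.induction_on with
  | zero => simp
  | add a b ha hb => simp only [add_mul, map_add, ha, hb]; abel
  | tmul a m =>
    induction y using TensorProduct.induction_on with
    | zero => simp
    | add a b ha hb => simp only [mul_add, map_add, ha, hb]; abel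
    | tmul b n =>
      simp [gExt, Algebra.TensorProduct.tmul_mul_tmul, TensorProduct.add_tmul, mul_comm, add_comm]

/-- the odd part -/
def gOdd (ξ : Fin 7 → Λ) : Submodule ℂ (GA ⊗[ℂ] Λ) :=
  Submodule.span ℂ {x | ∃ (a : GA) (k : Fin 7), x = a ⊗ₜ ξ k}

theorem gOdd_anti {ξ : Fin 7 → Λ} (hξ : ∀ i j, ξ i * ξ j = -(ξ j * ξ i)) {x y : (GA ⊗[ℂ] Λ)} (hx : x ∈ gOdd ξ) (hy : y ∈ gOdd ξ) : x * y = -(y * x) := by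
  induction hx using Submodule.span_induction with
  | zero => simp
  | add a b _ _ ha hb => rw [add_mul, mul_add, ha, hb]; abel
  | smul c a _ ha => rw [smul_mul_assoc, mul_smul_comm, ha, smul_neg]
  | mem x h =>
    obtain ⟨a, m, rfl⟩ := h
    induction hy using Submodule.span_induction with
    | zero => simp
    | add a b _ _ ha hb => rw [add_mul, mul_add, ha, hb]; abel
    | smul c a _ ha => rw [smul_mul_assoc, mul_smul_comm, ha, smul_neg]
    | mem y h =>
      obtain ⟨b, n, rfl⟩ := h
      rw [Algebra.TensorProduct.tmul_mul_tmul, Algebra.TensorProduct.tmul_mul_tmul,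
        hξ m n, TensorProduct.tmul_neg,
        mul_comm]

theorem gOdd_sq {ξ : Fin 7 → Λ} (hξ : ∀ i j, ξ i * ξ j = -(ξ j * ξ i)) {x : (GA ⊗[ℂ] Λ)} (hx : x ∈ gOdd ξ) : x * x = 0 := by
  have h := gOdd_anti hξ hx hx
  have h2 : (2 : ℂ) • (x * x) = 0 := by
    rw [two_smul]; exact add_eq_zero_iff_eq_neg.mpr h
  exact (smul_eq_zero.mp h2).resolve_left two_ne_zero

theorem gOdd_ext {ξ : Fin 7 → Λ} (T : GA →ₗ[ℂ] GA) {x : (GA ⊗[ℂ] Λ)} (hx : x ∈ gOdd ξ) : gExt T x ∈ gOdd ξ := by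
  induction hx using Submodule.span_induction with
  | zero => simp
  | add a b _ _ ha hb => rw [map_add]; exact add_mem ha hb
  | smul c a _ ha => rw [map_smul]; exact Submodule.smul_mem _ _ ha
  | mem x h =>
    obtain ⟨a, m, rfl⟩ := h
    exact Submodule.subset_span ⟨T a, m, by simp [gExt]⟩


/-- the odd vector field -/
def gD (ξ : Fin 7 → Λ) (X : Fin 7 → Vect 2) : (GA ⊗[ℂ] Λ) →ₗ[ℂ] (GA ⊗[ℂ] Λ) :=
  ∑ k, (LinearMap.mulLeft ℂ ((1 : GA) ⊗ₜ[ℂ] ξ k)) ∘ₗ gExt (X k).toLinearMap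

def gcoef (ξ : Fin 7 → Λ) (X : Fin 7 → Vect 2) (i : Fin 2) : (GA ⊗[ℂ] Λ) := ∑ k, X k (MvPolynomial.X i) ⊗ₜ ξ k

theorem gcoef_mem (ξ : Fin 7 → Λ) (X : Fin 7 → Vect 2) (i : Fin 2) : gcoef ξ X i ∈ gOdd ξ :=
  sum_mem fun _ _ => Submodule.subset_span ⟨_, _, rfl⟩

abbrev gd (i : Fin 2) : (GA ⊗[ℂ] Λ) →ₗ[ℂ] (GA ⊗[ℂ] Λ) := gExt (MvPolynomial.pderiv (R := ℂ) i).toLinearMap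

theorem gD_eq (ξ : Fin 7 → Λ) (X : Fin 7 → Vect 2) (x : (GA ⊗[ℂ] Λ)) :
    gD ξ X x = gcoef ξ X 0 * gd 0 x + gcoef ξ X 1 * gd 1 x := by
  induction x using TensorProduct.induction_on with
  | zero => simp
  | add a b ha hb => simp only [mul_add, map_add, ha, hb]; abel
  | tmul f m =>
    have key : ∀ k, X k f = X k (MvPolynomial.X 0) * MvPolynomial.pderiv 0 f
        + X k (MvPolynomial.X 1) * MvPolynomial.pderiv 1 f := by
      intro k
      have : X k = X k (MvPolynomial.X 0) • MvPolynomial.pderiv 0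
          + X k (MvPolynomial.X 1) • MvPolynomial.pderiv 1 := by
        apply MvPolynomial.derivation_ext
        intro i
        fin_cases i <;> simp [MvPolynomial.pderiv_X]
      conv_lhs => rw [this]
      simp
    simp [gD, gcoef, gExt, Finset.sum_mul, key, TensorProduct.add_tmul, mul_add, Finset.sum_add_distrib]

theorem gd_comm (x : (GA ⊗[ℂ] Λ)) : gd 1 (gd 0 x) = gd 0 (gd 1 x) := by
  induction x using TensorProduct.induction_on with
  | zero => simp
  | add a b ha hb => simp only [map_add, ha, hb]
  | tmul f m =>
    have : MvPolynomial.pderiv 1 (MvPolynomial.pderiv 0 f)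
        = MvPolynomial.pderiv 0 (MvPolynomial.pderiv 1 f) := by
      have h : ⁅(MvPolynomial.pderiv 1 : Vect 2), (MvPolynomial.pderiv 0 : Vect 2)⁆ = 0 := by
        apply MvPolynomial.derivation_ext
        intro i
        fin_cases i <;> simp [Derivation.commutator_apply, MvPolynomial.pderiv_X]
      have h2 := congrArg (fun d : Vect 2 => d f) h
      simpa [Derivation.commutator_apply, sub_eq_zero] using h2
    simp [gExt, this]

/-- the jets of the coefficients -/
def jets {B : Type*} [Zero B] (d e : B → B) (u v : B) : ℕ → B
  | 0 => u
  | 1 => v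
  | 2 => d u
  | 3 => e u
  | 4 => d v
  | 5 => e v
  | 6 => d (d u)
  | 7 => d (e u)
  | 8 => e (e u)
  | 9 => d (d v)
  | 10 => d (e v)
  | 11 => e (e v)
  | 12 => d (d (d u))
  | 13 => d (d (e u))
  | 14 => d (e (e u))
  | 15 => e (e (e u))
  | 16 => d (d (d v))
  | 17 => d (d (e v))
  | 18 => d (e (e v))
  | 19 => e (e (e v))
  | _ => 0

theorem jets_mem {B : Type*} [Zero B] (d e : B → B) (u v : B) (S : B → Prop) (h0 : S 0)
    (hu : S u) (hv : S v) (hd : ∀ x, S x → S (d x)) (he : ∀ x, S x → S (e x)) (n : ℕ) :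
    S (jets d e u v n) := by
  unfold jets
  split <;> repeat' first | assumption | apply hd | apply he

theorem odd_core_jets {B : Type*} [Ring B] (d e : B →+ B) (u v : B) (S : B → Prop) (h0 : S 0)
    (hu : S u) (hv : S v) (hd : ∀ x, S x → S (d x)) (he : ∀ x, S x → S (e x))
    (L1 : ∀ x y, d (x * y) = d x * y + x * d y)
    (L2 : ∀ x y, e (x * y) = e x * y + x * e y)
    (hc : ∀ x, e (d x) = d (e x))
    (hs : ∀ x, S x → x * x = 0) (ha : ∀ x y, S x → S y → x * y = -(y * x))
    (D : B → B) (hD : ∀ x, D x = u * d x + v * e x) (F : B) :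
    D (D (D (D (D (D (D F)))))) = 0 := by
  have hm := jets_mem d e u v S h0 hu hv hd he
  apply odd_core d e (jets d e u v) L1 L2 hc (fun i => hs _ (hm i))
    (fun i j _ => ha _ _ (hm i) (hm j)) (D := D) (hD := hD) <;> simp only [jets, hc]

theorem pow_seven_apply {B : Type*} [AddCommMonoid B] [Module ℂ B] (L : Module.End ℂ B) (F : B) :
    (L ^ 7) F = L (L (L (L (L (L (L F)))))) := by
  rw [Module.End.pow_apply]; rfl

theorem odd_core_alg {B : Type*} [Ring B] [Algebra ℂ B] (d e D : B →ₗ[ℂ] B) (u v : B)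
    (S : Submodule ℂ B) (hu : u ∈ S) (hv : v ∈ S)
    (hd : ∀ x ∈ S, d x ∈ S) (he : ∀ x ∈ S, e x ∈ S)
    (L1 : ∀ x y, d (x * y) = d x * y + x * d y)
    (L2 : ∀ x y, e (x * y) = e x * y + x * e y)
    (hc : ∀ x, e (d x) = d (e x))
    (hs : ∀ x ∈ S, x * x = 0) (ha : ∀ x y, x ∈ S → y ∈ S → x * y = -(y * x))
    (hD : ∀ x, D x = u * d x + v * e x) (F : B) : (D ^ 7) F = 0 := by
  rw [pow_seven_apply]
  exact odd_core_jets d.toAddMonoidHom e.toAddMonoidHom u v (fun x => x ∈ S) (zero_mem _) hu hv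
    hd he L1 L2 hc hs ha D hD F

theorem gD_seven (ξ : Fin 7 → Λ) (hξ : ∀ i j, ξ i * ξ j = -(ξ j * ξ i)) (X : Fin 7 → Vect 2)
    (F : GA ⊗[ℂ] Λ) : ((gD ξ X) ^ 7) F = 0 := by
  have h1 := gd_comm (Λ := Λ)
  have h2 := gD_eq ξ X
  have h3 := gExt_leibniz (Λ := Λ) (MvPolynomial.pderiv 0)
  have h4 := gExt_leibniz (Λ := Λ) (MvPolynomial.pderiv 1)
  have h5 : ∀ x ∈ gOdd ξ, gd 0 x ∈ gOdd ξ := fun _ h => gOdd_ext _ h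
  have h6 : ∀ x ∈ gOdd ξ, gd 1 x ∈ gOdd ξ := fun _ h => gOdd_ext _ h
  have h7 := gcoef_mem ξ X 0
  have h8 := gcoef_mem ξ X 1
  generalize gD ξ X = D at *
  generalize gcoef ξ X 0 = u at *
  generalize gcoef ξ X 1 = v at *
  unfold gd at *
  generalize gExt (Λ := Λ) (MvPolynomial.pderiv (R := ℂ) (0 : Fin 2)).toLinearMap = d at *
  generalize gExt (Λ := Λ) (MvPolynomial.pderiv (R := ℂ) (1 : Fin 2)).toLinearMap = e at *
  exact odd_core_alg d e D u v (gOdd ξ) h7 h8 h5 h6 h3 h4 h1 (fun _ h => gOdd_sq hξ h)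
    (fun _ _ h h' => gOdd_anti hξ h h') h2 F

theorem gD_pow (ξ : Fin 7 → Λ) (X : Fin 7 → Vect 2) (f : GA) (n : ℕ) :
    ((gD ξ X) ^ n) (f ⊗ₜ 1) = ∑ s : Fin n → Fin 7,
      ((List.ofFn fun i => (X (s i)).toLinearMap).prod f) ⊗ₜ[ℂ]
        (List.ofFn fun i => ξ (s i)).prod := by
  induction n with
  | zero => simp
  | succ n ih =>
    rw [pow_succ', Module.End.mul_apply, ih, ← (Fin.consEquiv fun _ => Fin 7).sum_comp,
      Fintype.sum_prod_type]
    simp [gD, gExt, List.ofFn_succ, Fin.consEquiv]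
    exact Finset.sum_comm

theorem gdet_perm {K : Type*} [CommRing K] {k : ℕ} (σ : Equiv.Perm (Fin k)) :
    Matrix.det (Matrix.of fun i => (Pi.single (σ i) 1 : Fin k → K)) = (Equiv.Perm.sign σ : ℤ) := by
  have h : (Matrix.of fun i => (Pi.single (σ i) 1 : Fin k → K)) = σ.permMatrix K := by
    ext i j
    simp [Equiv.Perm.permMatrix, PEquiv.toMatrix_apply, Pi.single_apply, eq_comm]
  rw [h, Matrix.det_permutation]

theorem gdet_zero {K : Type*} [CommRing K] {k : ℕ} (s : Fin k → Fin k)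
    (hni : ¬ Function.Injective s) :
    Matrix.det (Matrix.of fun i => (Pi.single (s i) 1 : Fin k → K)) = 0 := by
  obtain ⟨i, j, hij, hne⟩ : ∃ i j, s i = s j ∧ i ≠ j := by
    simpa [Function.Injective] using hni
  exact Matrix.det_zero_of_row_eq hne (by ext; simp [hij])

theorem sum_prod_zero_aux (ξ : Fin 7 → Λ) (hξ : ∀ i j, ξ i * ξ j = -(ξ j * ξ i))
    (φ : Λ →ₗ[ℂ] ℂ) (hφ : ∀ s : Fin 7 → Fin 7, φ (List.ofFn fun i => ξ (s i)).prod
      = Matrix.det (Matrix.of fun i => (Pi.single (s i) 1 : Fin 7 → ℂ)))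
    (X : Fin 7 → Vect 2) (f : GA) :
    ∑ σ : Equiv.Perm (Fin 7), (Equiv.Perm.sign σ : ℤ) •
      (List.ofFn fun i => (X (σ i)).toLinearMap).prod f = 0 := by
  have h := gD_pow ξ X f 7
  rw [gD_seven ξ hξ] at h
  have h2 := congrArg (fun z => TensorProduct.rid ℂ GA (φ.lTensor GA z)) h
  simp only [map_zero, map_sum, LinearMap.lTensor_tmul, TensorProduct.rid_tmul, hφ] at h2
  rw [h2]
  refine Finset.sum_of_injOn (fun σ => (σ : Fin 7 → Fin 7)) ?_ ?_ ?_ ?_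
  · exact fun a _ b _ h => DFunLike.coe_injective h
  · simp
  · intro s _ hs
    have hni : ¬ Function.Injective s := fun hi => hs
      ⟨Equiv.ofBijective s (Finite.injective_iff_bijective.mp hi), by simp, rfl⟩
    rw [gdet_zero s hni, zero_smul]
  · intro σ _
    rw [gdet_perm, Int.cast_smul_eq_zsmul]

end generic

theorem exists_top (K : Type*) [CommRing K] (k : ℕ) :
    ∃ φ : ExteriorAlgebra K (Fin k → K) →ₗ[K] K, ∀ s : Fin k → Fin k,
      φ (List.ofFn fun i => ExteriorAlgebra.ι K (Pi.single (s i) 1 : Fin k → K)).prod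
        = Matrix.det (Matrix.of fun i => (Pi.single (s i) 1 : Fin k → K)) := by
  refine ⟨ExteriorAlgebra.liftAlternating
    (Pi.single (M := fun i => (Fin k → K) [⋀^Fin i]→ₗ[K] K) k Matrix.detRowAlternating), ?_⟩
  intro s
  rw [← ExteriorAlgebra.ιMulti_apply, ExteriorAlgebra.liftAlternating_apply_ιMulti,
    Pi.single_eq_same]
  rfl

theorem sum_prod_zero (X : Fin 7 → Vect 2) (f : GA) :
    ∑ σ : Equiv.Perm (Fin 7), (Equiv.Perm.sign σ : ℤ) •
      (List.ofFn fun i => (X (σ i)).toLinearMap).prod f = 0 := by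
  obtain ⟨φ, hφ⟩ := exists_top ℂ 7
  exact sum_prod_zero_aux (fun k => ExteriorAlgebra.ι ℂ (Pi.single k 1 : Fin 7 → ℂ))
    (fun i j => eq_neg_of_add_eq_zero_left (ExteriorAlgebra.ι_add_mul_swap _ _)) φ hφ X f

theorem ofFn_rev {α : Type*} {n : ℕ} (g : Fin n → α) :
    (List.ofFn g).reverse = List.ofFn fun i => g (Fin.rev i) := by
  apply List.ext_getElem
  · simp
  · intro i h1 h2
    simp only [List.getElem_reverse, List.getElem_ofFn, List.length_ofFn]
    congr 1
    ext
    simp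
    omega

theorem sEnd_eq {A : Type*} [AddCommGroup A] [Module ℂ A] {k : ℕ} (T : Fin k → Module.End ℂ A) :
    sEnd T = (Equiv.Perm.sign (Fin.revPerm (n := k)) : ℤ) • ∑ σ : Equiv.Perm (Fin k),
      (Equiv.Perm.sign σ : ℤ) • (List.ofFn fun i : Fin k => T (σ i)).prod := by
  rw [sEnd, ← Equiv.sum_comp (Equiv.mulRight (Fin.revPerm (n := k))) (fun σ =>
    (Equiv.Perm.sign σ : ℤ) • (List.ofFn fun i : Fin k => T (σ i)).prod), Finset.smul_sum]
  refine Finset.sum_congr rfl fun σ _ => ?_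
  rw [ofFn_rev, smul_smul]
  congr 1
  simp only [Equiv.coe_mulRight, Equiv.Perm.sign_mul, Units.val_mul]
  rw [mul_comm, mul_assoc, ← Units.val_mul, Int.units_mul_self, Units.val_one, mul_one]

theorem sEnd_zero_of {A : Type*} [AddCommGroup A] [Module ℂ A] {k : ℕ} (T : Fin k → Module.End ℂ A)
    (h : ∀ f, ∑ σ : Equiv.Perm (Fin k), (Equiv.Perm.sign σ : ℤ) •
      (List.ofFn fun i => T (σ i)).prod f = 0) : sEnd T = 0 := by
  rw [sEnd_eq]
  refine LinearMap.ext fun f => ?_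
  rw [LinearMap.smul_apply, LinearMap.sum_apply, LinearMap.zero_apply]
  simp only [LinearMap.smul_apply]
  rw [h, smul_zero]

theorem sEnd_zero (X : Fin 7 → Vect 2) :
    sEnd (fun i => (X i).toLinearMap) = 0 :=
  sEnd_zero_of _ (sum_prod_zero X)

end

/-- `s₇ = 0` is an identity on vector fields in two variables. -/
theorem stmt_14 (X : Fin 7 → Vect 2) :
    sEnd (fun i => (X i).toLinearMap) = 0 := by
  exact sEnd_zero X
end

section
/- The 6-commutator s₆ on vector fields in two variables is primitive: there is no element f of the free Lie algebra FreeLieAlgebra ℂ (Fin 6) such that for every family X : Fin 6 → Derivation ℂ A₂ A₂, the image of f under the universal Lie algebra homomorphism FreeLieAlgebra.lift ℂ X equals, as a ℂ-linear endomorphism of A₂, s₆(X 0, X 1, X 2, X 3, X 4, X 5). In other words, s₆ on Vect(2) is not given by any Lie polynomial in its arguments. -/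
namespace SixComm

/-! ### An explicit nonzero value of `s₆` -/

def ea : Fin 6 → ℕ := ![0,0,1,1,0,0]
def eb : Fin 6 → ℕ := ![0,0,0,0,1,2]
def ed : Fin 6 → Bool := ![true,false,true,false,false,false]

/-- Action of the monomial vector field `x^(ea i) y^(eb i) ∂` on a monomial `c x^m y^n`. -/
def act (s : ℤ × ℕ × ℕ) (i : Fin 6) : ℤ × ℕ × ℕ :=
  if ed i then (s.1 * s.2.1, s.2.1 - 1 + ea i, s.2.2 + eb i)
  else (s.1 * s.2.2, s.2.1 + ea i, s.2.2 - 1 + eb i)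

lemma key : ∑ σ : Equiv.Perm (Fin 6), (Equiv.Perm.sign σ : ℤ) *
    ((List.ofFn fun i => σ i).foldl act (1,0,1)).1 = -2 := by
  decide +kernel

noncomputable section

open MvPolynomial

attribute [local instance] LieRing.ofAssociativeRing

/-- The six monomial vector fields. -/
def V (i : Fin 6) : Vect 2 :=
  (X 0 ^ ea i * X 1 ^ eb i : MvPolynomial (Fin 2) ℂ) • pderiv (if ed i then 0 else 1)

def mono (s : ℤ × ℕ × ℕ) : MvPolynomial (Fin 2) ℂ := (s.1 : MvPolynomial (Fin 2) ℂ) *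
  (X 0 ^ s.2.1 * X 1 ^ s.2.2)

lemma V_mono (s : ℤ × ℕ × ℕ) (i : Fin 6) : V i (mono s) = mono (act s i) := by
  obtain ⟨c, m, n⟩ := s
  unfold V mono act
  cases h : ed i
  · simp [Derivation.leibniz, Derivation.leibniz_pow, pderiv_X]
    ring
  · simp [Derivation.leibniz, Derivation.leibniz_pow, pderiv_X]
    ring

lemma prod_mono (l : List (Fin 6)) (s : ℤ × ℕ × ℕ) :
    (l.map fun i => (V i).toLinearMap).reverse.prod (mono s) = mono (l.foldl act s) := by
  induction l generalizing s with
  | nil => simp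
  | cons i l ih =>
    simp only [List.map_cons, List.reverse_cons, List.prod_append, List.prod_singleton,
      Module.End.mul_apply, List.foldl_cons]
    rw [← ih]
    congr 1
    exact V_mono s i

/-- Evaluate an endomorphism at `y`, then at the point `(1,1)`. -/
def L : Module.End ℂ (MvPolynomial (Fin 2) ℂ) →ₗ[ℂ] ℂ :=
  (aeval (R := ℂ) (fun _ : Fin 2 => (1 : ℂ))).toLinearMap ∘ₗ LinearMap.applyₗ (mono (1,0,1))

lemma L_apply (T) : L T = aeval (R := ℂ) (fun _ : Fin 2 => (1 : ℂ)) (T (mono (1,0,1))) := rfl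

lemma L_val : L (sEnd fun i => (V i).toLinearMap) = -2 := by
  have h := congrArg (Int.cast : ℤ → ℂ) key
  push_cast at h
  rw [← h]
  unfold sEnd
  rw [map_sum]
  refine Finset.sum_congr rfl fun σ _ => ?_
  rw [map_zsmul, L_apply]
  have : (List.ofFn fun i => (V (σ i)).toLinearMap)
      = (List.ofFn fun i => σ i).map fun i => (V i).toLinearMap := by
    rw [List.map_ofFn]; rfl
  rw [this, prod_mono]
  simp [mono]

/-! ### Lie elements in the exterior algebra -/

abbrev G := ExteriorAlgebra ℂ (Fin 6 → ℂ)

abbrev io : (Fin 6 → ℂ) →ₗ[ℂ] G := ExteriorAlgebra.ι ℂ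

def M2 : Submodule ℂ G := Submodule.span ℂ {g | ∃ a b, g = io a * io b}

lemma anti (a b : Fin 6 → ℂ) : io a * io b = - (io b * io a) :=
  eq_neg_of_add_eq_zero_left (ExteriorAlgebra.ι_add_mul_swap a b)

lemma M2_central {g : G} (hg : g ∈ M2) (h : G) : g * h = h * g := by
  induction hg using Submodule.span_induction with
  | zero => simp
  | add x y _ _ hx hy => rw [add_mul, mul_add, hx, hy]
  | smul c x _ hx => rw [smul_mul_assoc, hx, mul_smul_comm]
  | mem x hx =>
    obtain ⟨a, b, rfl⟩ := hx
    induction h using ExteriorAlgebra.induction with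
    | algebraMap r => exact (Algebra.commutes r _).symm
    | ι c =>
      change io a * io b * io c = io c * (io a * io b)
      rw [mul_assoc, anti b c, mul_neg, ← mul_assoc, anti a c, neg_mul, neg_neg, mul_assoc]
    | mul x y hx hy => rw [← mul_assoc, hx, mul_assoc, hy, mul_assoc]
    | add x y hx hy => rw [mul_add, add_mul, hx, hy]

/-- Degrees one and two of the exterior algebra form a Lie subalgebra. -/
def K : LieSubalgebra ℂ G where
  toSubmodule := LinearMap.range io ⊔ M2
  lie_mem' := by
    intro x y hx hy
    obtain ⟨_, ⟨a, rfl⟩, m, hm, rfl⟩ := Submodule.mem_sup.1 hx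
    obtain ⟨_, ⟨b, rfl⟩, n, hn, rfl⟩ := Submodule.mem_sup.1 hy
    refine Submodule.mem_sup_right ?_
    have : ⁅io a + m, io b + n⁆ = io a * io b - io b * io a := by
      rw [Ring.lie_def, add_mul, mul_add, add_mul, mul_add, mul_add,
        M2_central hm, M2_central hn, add_mul]
      abel
    rw [this]
    exact sub_mem (Submodule.subset_span ⟨_, _, rfl⟩) (Submodule.subset_span ⟨_, _, rfl⟩)

/-- The top-degree coefficient. -/
def D : G →ₗ[ℂ] ℂ := ExteriorAlgebra.liftAlternating (Pi.single 6 Matrix.detRowAlternating)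

lemma D_word {n : ℕ} (v : Fin n → Fin 6 → ℂ) :
    D (List.ofFn fun i => io (v i)).prod =
      (Pi.single 6 Matrix.detRowAlternating : ∀ i, (Fin 6 → ℂ) [⋀^Fin i]→ₗ[ℂ] ℂ) n v := by
  rw [← ExteriorAlgebra.ιMulti_apply]
  exact ExteriorAlgebra.liftAlternating_apply_ιMulti _ _

lemma D_word_ne {n : ℕ} (h : n ≠ 6) (v : Fin n → Fin 6 → ℂ) :
    D (List.ofFn fun i => io (v i)).prod = 0 := by
  rw [D_word, Pi.single_eq_of_ne h]; rfl

lemma D_word_six (v : Fin 6 → Fin 6 → ℂ) :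
    D (List.ofFn fun i => io (v i)).prod = Matrix.det v := by
  rw [D_word, Pi.single_eq_same]; rfl

lemma D_K {g : G} (hg : g ∈ K) : D g = 0 := by
  change g ∈ LinearMap.range io ⊔ M2 at hg
  have : LinearMap.range io ⊔ M2 ≤ LinearMap.ker D := by
    refine sup_le ?_ (Submodule.span_le.2 ?_)
    · rintro _ ⟨a, rfl⟩
      simpa using D_word_ne (n := 1) (by norm_num) ![a]
    · rintro _ ⟨a, b, rfl⟩
      simpa using D_word_ne (n := 2) (by norm_num) ![a, b]
  exact this hg

/-! ### Words -/

abbrev FA := FreeAlgebra ℂ (Fin 6)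

lemma exists_words (F : FA) : ∃ c : List (Fin 6) →₀ ℂ,
    F = c.sum fun w a => a • (w.map (FreeAlgebra.ι ℂ)).prod := by
  have h : F ∈ Submodule.span ℂ (Set.range fun w : List (Fin 6) =>
      (w.map (FreeAlgebra.ι ℂ) : List FA).prod) := by
    induction F using FreeAlgebra.induction with
    | grade0 r =>
      rw [Algebra.algebraMap_eq_smul_one]
      exact Submodule.smul_mem _ _ (Submodule.subset_span ⟨[], by simp⟩)
    | grade1 x => exact Submodule.subset_span ⟨[x], by simp⟩
    | add a b ha hb => exact add_mem ha hb
    | mul a b ha hb =>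
      have := Submodule.mul_mem_mul ha hb
      rw [Submodule.span_mul_span] at this
      refine Submodule.span_mono ?_ this
      rintro _ ⟨_, ⟨u, rfl⟩, _, ⟨v, rfl⟩, rfl⟩
      exact ⟨u ++ v, by simp⟩
  obtain ⟨c, hc⟩ := (Finsupp.mem_span_range_iff_exists_finsupp).1 h
  exact ⟨c, hc.symm⟩

lemma lift_words {B : Type*} [Ring B] [Algebra ℂ B] (x : Fin 6 → B) (c : List (Fin 6) →₀ ℂ) :
    FreeAlgebra.lift ℂ x (c.sum fun w a => a • (w.map (FreeAlgebra.ι ℂ)).prod) =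
      c.sum fun w a => a • (w.map x).prod := by
  rw [Finsupp.sum, map_sum]
  refine Finset.sum_congr rfl fun w _ => ?_
  rw [map_smul, map_list_prod, List.map_map]
  congr 3
  funext i
  simp

/-- The word uses each letter exactly once. -/
def ML (w : List (Fin 6)) : Prop := ∀ i, w.count i = 1

instance : DecidablePred ML := fun w => inferInstanceAs (Decidable (∀ i, w.count i = 1))

lemma ML_perm {w : List (Fin 6)} (h : ML w) : ∃ σ : Equiv.Perm (Fin 6), w = List.ofFn σ := by
  have hp : w.Perm (List.finRange 6) := by
    rw [List.perm_iff_count]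
    intro a
    rw [h a]
    exact (List.count_eq_one_of_mem (List.nodup_finRange 6) (List.mem_finRange a)).symm
  have hl : w.length = 6 := by simpa using hp.length_eq
  have hn : w.Nodup := hp.nodup_iff.2 (List.nodup_finRange 6)
  have hinj : Function.Injective fun i : Fin 6 => w.get (i.cast hl.symm) := by
    intro i j hij
    have := List.nodup_iff_injective_get.1 hn hij
    simpa [Fin.ext_iff] using this
  refine ⟨Equiv.ofBijective _ (Finite.injective_iff_bijective.1 hinj), ?_⟩
  apply List.ext_get
  · simp [hl]
  · intro n h1 h2
    simp [-List.ofFn_succ]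

/-- The sign functional on words. -/
def φ (w : List (Fin 6)) : ℂ := D (w.map fun i => io (Pi.single i 1)).prod

lemma φ_perm (σ : Equiv.Perm (Fin 6)) : φ (List.ofFn σ) = ((Equiv.Perm.sign σ : ℤ) : ℂ) := by
  unfold φ
  rw [List.map_ofFn]
  refine (D_word_six fun i => Pi.single (σ i) 1).trans ?_
  rw [← Matrix.det_permutation σ]
  congr 1
  ext i j
  simp [Equiv.Perm.permMatrix, PEquiv.toMatrix_apply, Pi.single_apply, eq_comm]

lemma φ_not {w : List (Fin 6)} (h : ¬ ML w) : φ w = 0 := by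
  obtain ⟨n, v, rfl⟩ : ∃ n, ∃ v : Fin n → Fin 6, w = List.ofFn v :=
    ⟨w.length, w.get, (List.ofFn_get w).symm⟩
  unfold φ
  rw [List.map_ofFn]
  by_cases hn : n = 6
  · subst hn
    refine (D_word_six fun i => Pi.single (v i) 1).trans ?_
    by_cases hv : Function.Injective v
    · exfalso
      apply h
      intro i
      obtain ⟨j, rfl⟩ := (Finite.injective_iff_surjective.1 hv) i
      exact List.count_eq_one_of_mem (List.nodup_ofFn.2 hv) (List.mem_ofFn.2 ⟨j, rfl⟩)
    · simp only [Function.Injective, not_forall] at hv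
      obtain ⟨i, j, hij, hne⟩ := hv
      exact Matrix.det_zero_of_row_eq hne (by simp [hij])
  · exact D_word_ne hn fun i => Pi.single (v i) 1

lemma φ_lie (f : FreeLieAlgebra ℂ (Fin 6)) (c : List (Fin 6) →₀ ℂ)
    (hc : FreeLieAlgebra.lift ℂ (FreeAlgebra.ι ℂ : Fin 6 → FA) f =
      c.sum fun w a => a • (w.map (FreeAlgebra.ι ℂ)).prod) :
    (c.sum fun w a => a * φ w) = 0 := by
  let x : Fin 6 → G := fun i => io (Pi.single i 1)
  have hx : ∀ i, x i ∈ K := fun i => Submodule.mem_sup_left ⟨_, rfl⟩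
  have h1 : K.incl.comp (FreeLieAlgebra.lift ℂ fun i => (⟨x i, hx i⟩ : K)) =
      (FreeAlgebra.lift ℂ x).toLieHom.comp
        (FreeLieAlgebra.lift ℂ (FreeAlgebra.ι ℂ : Fin 6 → FA)) := by
    apply FreeLieAlgebra.hom_ext
    intro i
    simp [FreeLieAlgebra.lift_of_apply]
  have h2 := LieHom.congr_fun h1 f
  simp only [LieHom.comp_apply, AlgHom.coe_toLieHom] at h2
  rw [hc] at h2
  erw [lift_words] at h2
  have h3 : D (c.sum fun w a => a • (w.map x).prod) = 0 := by
    rw [← h2]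
    exact D_K (Subtype.property _)
  rw [Finsupp.sum, map_sum] at h3
  rw [← h3]
  refine Finset.sum_congr rfl fun w _ => ?_
  rw [map_smul]; rfl

/-! ### Lie polynomials on vector fields -/

abbrev E := Module.End ℂ (MvPolynomial (Fin 2) ℂ)

def toE : Vect 2 →ₗ⁅ℂ⁆ E where
  toFun X := X.toLinearMap
  map_add' _ _ := rfl
  map_smul' _ _ := rfl
  map_lie' := by
    intro X Y
    ext1
    rfl

lemma lift_eq (f : FreeLieAlgebra ℂ (Fin 6)) (X : Fin 6 → Vect 2) :
    (FreeLieAlgebra.lift ℂ X f).toLinearMap =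
      FreeAlgebra.lift ℂ (fun i => ((X i).toLinearMap : E))
        (FreeLieAlgebra.lift ℂ (FreeAlgebra.ι ℂ : Fin 6 → FA) f) := by
  have h1 : toE.comp (FreeLieAlgebra.lift ℂ X) =
      (FreeAlgebra.lift ℂ (fun i => ((X i).toLinearMap : E))).toLieHom.comp
        (FreeLieAlgebra.lift ℂ (FreeAlgebra.ι ℂ : Fin 6 → FA)) := by
    apply FreeLieAlgebra.hom_ext
    intro i
    simp [FreeLieAlgebra.lift_of_apply, toE]
  exact LieHom.congr_fun h1 f

lemma word_smul (w : List (Fin 6)) (t : Fin 6 → ℂ) (T : Fin 6 → E) :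
    (w.map fun i => t i • T i).prod = (w.map t).prod • (w.map T).prod := by
  induction w with
  | nil => simp
  | cons i w ih =>
    simp only [List.map_cons, List.prod_cons]
    rw [ih, smul_mul_smul_comm]

lemma sEnd_smul (t : Fin 6 → ℂ) (T : Fin 6 → E) :
    sEnd (fun i => t i • T i) = (∏ i, t i) • sEnd T := by
  unfold sEnd
  rw [Finset.smul_sum]
  refine Finset.sum_congr rfl fun σ _ => ?_
  have h : ∀ T : Fin 6 → E, (List.ofFn fun i => T (σ i)).reverse =
      ((List.ofFn σ).reverse).map T := by
    intro T
    rw [List.map_reverse, List.map_ofFn]; rfl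
  rw [h (fun i => t i • T i), h T, word_smul, smul_comm]
  have h2 : ((List.ofFn σ).reverse.map t).prod = ∏ i, t i := by
    rw [List.map_reverse, List.prod_reverse, List.map_ofFn, List.prod_ofFn]
    exact Equiv.prod_comp σ t
  rw [h2]

lemma sEnd_perm (τ : Equiv.Perm (Fin 6)) (T : Fin 6 → E) :
    sEnd (fun i => T (τ i)) = (Equiv.Perm.sign τ : ℤ) • sEnd T := by
  unfold sEnd
  rw [Finset.smul_sum]
  refine Fintype.sum_equiv (Equiv.mulLeft τ) _ _ fun σ => ?_
  simp only [Equiv.coe_mulLeft, Equiv.Perm.sign_mul, Equiv.Perm.coe_mul, Function.comp_apply]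
  rw [smul_smul]
  congr 1
  rcases Int.units_eq_one_or (Equiv.Perm.sign τ) with h | h <;> simp [h]

lemma word_perm {w : List (Fin 6)} (h : ML w) (T : Fin 6 → E) :
    ∑ τ : Equiv.Perm (Fin 6), (Equiv.Perm.sign τ : ℤ) • (w.map fun i => T (τ i)).prod =
      φ w • ∑ τ : Equiv.Perm (Fin 6), (Equiv.Perm.sign τ : ℤ) • (List.ofFn fun i => T (τ i)).prod := by
  obtain ⟨σ, rfl⟩ := ML_perm h
  have hz : ∀ (k : ℤ) (S : E), (k : ℂ) • S = k • S := fun k S => Int.cast_smul_eq_zsmul ℂ k S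
  rw [φ_perm, hz, Finset.smul_sum]
  refine Fintype.sum_equiv (Equiv.mulRight σ) _ _ fun τ => ?_
  simp only [Equiv.coe_mulRight, Equiv.Perm.sign_mul, Equiv.Perm.coe_mul, Function.comp_apply]
  rw [smul_smul, List.map_ofFn]
  congr 1
  rcases Int.units_eq_one_or (Equiv.Perm.sign σ) with h | h <;> simp [h]

lemma L_alt (T : Fin 6 → E) (w : List (Fin 6)) :
    L (∑ τ : Equiv.Perm (Fin 6), (Equiv.Perm.sign τ : ℤ) • (w.map fun i => T (τ i)).prod) =
      ∑ τ : Equiv.Perm (Fin 6), (Equiv.Perm.sign τ : ℤ) • L ((w.map fun i => T (τ i)).prod) := by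
  rw [map_sum]
  refine Finset.sum_congr rfl fun τ _ => ?_
  rw [map_zsmul]

lemma L_word {w : List (Fin 6)} (h : ML w) (T : Fin 6 → E) :
    ∑ τ : Equiv.Perm (Fin 6), (Equiv.Perm.sign τ : ℤ) • L ((w.map fun i => T (τ i)).prod) =
      φ w * L (∑ τ : Equiv.Perm (Fin 6),
        (Equiv.Perm.sign τ : ℤ) • (List.ofFn fun i => T (τ i)).prod) := by
  have h1 := word_perm h T
  have h2 := L_alt T w
  generalize (∑ τ : Equiv.Perm (Fin 6),
    (Equiv.Perm.sign τ : ℤ) • (List.ofFn fun i => T (τ i)).prod) = S at h1 ⊢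
  rw [← h2, h1, L.map_smul, smul_eq_mul]

lemma word_coeff (w : List (Fin 6)) :
    coeff (Finsupp.equivFunOnFinite.symm fun _ => 1)
      (w.map (X : Fin 6 → MvPolynomial (Fin 6) ℂ)).prod = if ML w then 1 else 0 := by
  have h : (w.map (X : Fin 6 → MvPolynomial (Fin 6) ℂ)).prod =
      monomial (Multiset.toFinsupp (w : Multiset (Fin 6))) 1 := by
    induction w with
    | nil => simp
    | cons i w ih =>
      rw [List.map_cons, List.prod_cons, ih, ← Multiset.cons_coe, ← Multiset.singleton_add,
        Multiset.toFinsupp_add, Multiset.toFinsupp_singleton, X, monomial_mul, one_mul]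
  rw [h, coeff_monomial]
  congr 1
  simp [Finsupp.ext_iff, ML]

/-- Extraction of the multilinear part. -/
lemma extract (c : List (Fin 6) →₀ ℂ) (T : Fin 6 → E)
    (h : ∀ t : Fin 6 → ℂ, (c.sum fun w a => a • (w.map fun i => t i • T i).prod) =
      sEnd fun i => t i • T i) :
    (∑ w ∈ c.support, if ML w then c w * L (w.map T).prod else 0) = L (sEnd T) := by
  have hP : (∑ w ∈ c.support, C (c w * L (w.map T).prod) *
      (w.map (X : Fin 6 → MvPolynomial (Fin 6) ℂ)).prod) = C (L (sEnd T)) * ∏ i, X i := by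
    apply MvPolynomial.funext
    intro t
    have h1 := congrArg L (h t)
    rw [sEnd_smul, map_smul, Finsupp.sum, map_sum] at h1
    simp only [map_sum, map_mul, eval_C, map_prod, eval_X, map_list_prod, List.map_map]
    rw [mul_comm, ← smul_eq_mul (∏ i, t i), ← h1]
    refine Finset.sum_congr rfl fun w _ => ?_
    rw [word_smul, map_smul, map_smul, smul_eq_mul, smul_eq_mul]
    have : (⇑(eval t) ∘ X) = t := by funext i; simp
    rw [this]
    ring
  have hQ : (∏ i, X i : MvPolynomial (Fin 6) ℂ) = ((List.ofFn id).map X).prod := by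
    rw [List.map_ofFn, List.prod_ofFn]; rfl
  have hid : ML (List.ofFn id) := by decide
  have h2 := congrArg (coeff (Finsupp.equivFunOnFinite.symm fun _ => 1)) hP
  rw [hQ, coeff_C_mul, word_coeff, if_pos hid, mul_one, coeff_sum] at h2
  rw [← h2]
  refine Finset.sum_congr rfl fun w _ => ?_
  rw [coeff_C_mul, word_coeff]
  split_ifs <;> simp

lemma main (f : FreeLieAlgebra ℂ (Fin 6))
    (hf : ∀ X : Fin 6 → Vect 2,
        (FreeLieAlgebra.lift ℂ X f).toLinearMap = sEnd (fun i => (X i).toLinearMap)) : False := by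
  obtain ⟨c, hc⟩ := exists_words (FreeLieAlgebra.lift ℂ (FreeAlgebra.ι ℂ : Fin 6 → FA) f)
  have hφ := φ_lie f c hc
  obtain ⟨T, hT⟩ : ∃ T : Fin 6 → E, T = fun i => (V i).toLinearMap := ⟨_, rfl⟩
  have hL : L (sEnd T) = -2 := by rw [hT]; exact L_val
  have h1 : ∀ τ : Equiv.Perm (Fin 6),
      (∑ w ∈ c.support, if ML w then c w * L (w.map fun i => T (τ i)).prod else 0) =
        (Equiv.Perm.sign τ : ℤ) • L (sEnd T) := by
    intro τ
    rw [← map_zsmul, ← sEnd_perm]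
    apply extract
    intro t
    have := hf fun i => t i • V (τ i)
    rw [lift_eq, hc, lift_words] at this
    subst hT
    exact this
  have h2 : ∑ τ : Equiv.Perm (Fin 6), (Equiv.Perm.sign τ : ℤ) •
      (∑ w ∈ c.support, if ML w then c w * L (w.map fun i => T (τ i)).prod else 0) =
      720 * L (sEnd T) := by
    have : ∀ τ : Equiv.Perm (Fin 6), (Equiv.Perm.sign τ : ℤ) •
      (∑ w ∈ c.support, if ML w then c w * L (w.map fun i => T (τ i)).prod else 0) =
        L (sEnd T) := by
      intro τ
      rw [h1, smul_smul]
      rcases Int.units_eq_one_or (Equiv.Perm.sign τ) with h | h <;> simp [h]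
    rw [Finset.sum_congr rfl fun τ _ => this τ, Finset.sum_const, Finset.card_univ,
      Fintype.card_perm, Fintype.card_fin]
    simp [Nat.factorial]
  have h3 : ∑ τ : Equiv.Perm (Fin 6), (Equiv.Perm.sign τ : ℤ) •
      (∑ w ∈ c.support, if ML w then c w * L (w.map fun i => T (τ i)).prod else 0) =
      (∑ w ∈ c.support, c w * φ w) * L (∑ τ : Equiv.Perm (Fin 6),
        (Equiv.Perm.sign τ : ℤ) • (List.ofFn fun i => T (τ i)).prod) := by
    simp_rw [Finset.smul_sum]
    rw [Finset.sum_comm, Finset.sum_mul]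
    refine Finset.sum_congr rfl fun w _ => ?_
    by_cases hw : ML w
    · have := L_word hw T
      rw [mul_assoc, ← this, Finset.mul_sum]
      refine Finset.sum_congr rfl fun τ _ => ?_
      rw [if_pos hw, mul_smul_comm]
    · simp [hw, φ_not hw]
  rw [h2] at h3
  rw [Finsupp.sum] at hφ
  rw [hφ, zero_mul, hL] at h3
  norm_num at h3

end

end SixComm

/-- the 6-commutator `s₆` on vector fields in two variables is
primitive: it is not given by any Lie polynomial. -/
theorem stmt_15 :
    ¬ ∃ f : FreeLieAlgebra ℂ (Fin 6),
      ∀ X : Fin 6 → Vect 2,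
        (FreeLieAlgebra.lift ℂ X f).toLinearMap =
          sEnd (fun i => (X i).toLinearMap) := by
  rintro ⟨f, hf⟩
  exact SixComm.main f hf
end

section
/- For all derivations X₁, …, X₇ ∈ Derivation ℂ A₂ A₂, both of the following hold, all expressions computed among ℂ-linear endomorphisms of A₂ (hats denoting omitted arguments): (a) ∑_{1 ≤ i < j ≤ 7} (−1)^{i+j} • s₆(⁅Xᵢ, Xⱼ⁆, X₁, …, X̂ᵢ, …, X̂ⱼ, …, X₇) = 0, and (b) ∑_{i=1}^{7} (−1)^{i} • ⁅Xᵢ, s₆(X₁, …, X̂ᵢ, …, X₇)⁆ = 0. Hence the Chevalley–Eilenberg coboundary of s₆ vanishes: s₆ is a 6-cocycle of the adjoint module of the Lie algebra of vector fields in two variables, and (Vect(2), {s₂, s₆}) is an sh-Lie algebra. -/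
open Equiv in
/-- Extension of a permutation of `Fin n` to `Fin (n+1)` fixing `0`. -/
def extP {n : ℕ} (e : Perm (Fin n)) : Perm (Fin (n + 1)) := Perm.decomposeFin.symm (0, e)

theorem extP_zero {n : ℕ} (e : Equiv.Perm (Fin n)) : extP e 0 = 0 := by
  simp [extP]

theorem extP_succ {n : ℕ} (e : Equiv.Perm (Fin n)) (q : Fin n) :
    extP e q.succ = (e q).succ := by
  simp [extP]

theorem extP_sign {n : ℕ} (e : Equiv.Perm (Fin n)) :
    Equiv.Perm.sign (extP e) = Equiv.Perm.sign e := by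
  simp [extP]

theorem extP_mul {n : ℕ} (d e : Equiv.Perm (Fin n)) : extP d * extP e = extP (d * e) := by
  ext q
  refine Fin.cases ?_ (fun q => ?_) q <;> simp [extP_zero, extP_succ]

theorem exists_extP {n : ℕ} (s : Equiv.Perm (Fin (n + 1))) (h : s 0 = 0) :
    ∃ d, s = extP d := by
  obtain ⟨⟨p, e⟩, rfl⟩ := Equiv.Perm.decomposeFin.symm.surjective s
  simp at h
  subst h
  exact ⟨e, rfl⟩

theorem sum_perm_left {n : ℕ} {N : Type*} [AddCommMonoid N]
    (h : Equiv.Perm (Fin (n + 1)) → N) :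
    ∑ s, h s = ∑ i : Fin (n + 1), ∑ e : Equiv.Perm (Fin n),
      h ((Fin.cycleRange i)⁻¹ * extP e) := by
  rw [← Equiv.sum_comp Equiv.Perm.decomposeFin.symm h, Fintype.sum_prod_type]
  refine Finset.sum_congr rfl fun i _ => ?_
  obtain ⟨d, hd⟩ := exists_extP (Fin.cycleRange i * Equiv.swap 0 i) (by simp)
  symm
  rw [← Equiv.sum_comp (Equiv.mulLeft d)]
  refine Finset.sum_congr rfl fun e _ => ?_
  congr 1
  rw [Equiv.coe_mulLeft, ← extP_mul, ← hd]
  ext q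
  refine Fin.cases ?_ (fun q => ?_) q <;> simp [extP_zero, extP_succ]

theorem sum_perm_right {n : ℕ} {N : Type*} [AddCommMonoid N]
    (h : Equiv.Perm (Fin (n + 1)) → N) :
    ∑ s, h s = ∑ i : Fin (n + 1), ∑ e : Equiv.Perm (Fin n),
      h (extP e * Fin.cycleRange i) := by
  rw [← Equiv.sum_comp (Equiv.inv _) h, sum_perm_left]
  refine Finset.sum_congr rfl fun i _ => ?_
  rw [← Equiv.sum_comp (Equiv.inv _)]
  refine Finset.sum_congr rfl fun e _ => ?_
  congr 1
  have : (extP e⁻¹)⁻¹ = extP e := by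
    rw [inv_eq_iff_mul_eq_one, extP_mul]
    ext q
    refine Fin.cases ?_ (fun q => ?_) q <;> simp [extP_zero, extP_succ]
  simp [this]

theorem cyc_extP_zero {n : ℕ} (i : Fin (n+1)) (e : Equiv.Perm (Fin n)) :
    ((Fin.cycleRange i)⁻¹ * extP e) 0 = i := by
  rw [Equiv.Perm.mul_apply, extP_zero]; exact Fin.cycleRange_symm_zero i

theorem cyc_extP_succ {n : ℕ} (i : Fin (n+1)) (e : Equiv.Perm (Fin n)) (q : Fin n) :
    ((Fin.cycleRange i)⁻¹ * extP e) q.succ = i.succAbove (e q) := by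
  rw [Equiv.Perm.mul_apply, extP_succ]; exact Fin.cycleRange_symm_succ i _

theorem cyc_extP_sign {n : ℕ} (i : Fin (n+1)) (e : Equiv.Perm (Fin n)) :
    ((Equiv.Perm.sign ((Fin.cycleRange i)⁻¹ * extP e) : ℤˣ) : ℤ)
      = (-1) ^ (i : ℕ) * (Equiv.Perm.sign e : ℤ) := by
  simp [extP_sign, Fin.sign_cycleRange]

theorem cyc_extP_sign' {n : ℕ} (i : Fin (n+1)) (e : Equiv.Perm (Fin n)) :
    ((Equiv.Perm.sign (extP e * Fin.cycleRange i) : ℤˣ) : ℤ)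
      = (-1) ^ (i : ℕ) * (Equiv.Perm.sign e : ℤ) := by
  simp [extP_sign, Fin.sign_cycleRange, mul_comm]

theorem sum_perm_even {n : ℕ} {N : Type*} [AddCommGroup N] (ρ : Equiv.Perm (Fin n))
    (hρ : Equiv.Perm.sign ρ = 1) (h : Equiv.Perm (Fin n) → N) :
    ∑ s, (Equiv.Perm.sign s : ℤ) • h s = ∑ s, (Equiv.Perm.sign s : ℤ) • h (s * ρ) := by
  rw [← Equiv.sum_comp (Equiv.mulRight ρ)]
  simp [hρ]

theorem sum_even_sub {n : ℕ} {N : Type*} [AddCommGroup N] (ρ : Equiv.Perm (Fin n))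
    (hρ : Equiv.Perm.sign ρ = 1) (F G : Equiv.Perm (Fin n) → N)
    (h : ∀ s, F (s * ρ) = G s) :
    ∑ s, (Equiv.Perm.sign s : ℤ) • (F s - G s) = 0 := by
  simp only [smul_sub, Finset.sum_sub_distrib]
  rw [sum_perm_even ρ hρ F, sub_eq_zero]
  exact Finset.sum_congr rfl fun s _ => by rw [h]

section
variable {A : Type*} [AddCommGroup A] [Module ℂ A]

theorem sEnd_six (U : Fin 6 → Module.End ℂ A) : sEnd U = ∑ τ : Equiv.Perm (Fin 6),
    (Equiv.Perm.sign τ : ℤ) •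
      (U (τ 5) * (U (τ 4) * (U (τ 3) * (U (τ 2) * (U (τ 1) * U (τ 0)))))) := by
  unfold sEnd
  refine Finset.sum_congr rfl fun τ _ => ?_
  congr 1


theorem partB_aux (T : Fin 7 → Module.End ℂ A) : 
    ∑ s : Equiv.Perm (Fin 7), (Equiv.Perm.sign s : ℤ) •
        (T (s 0) * (T (s 6) * (T (s 5) * (T (s 4) * (T (s 3) * (T (s 2) * T (s 1)))))) -
         T (s 6) * (T (s 5) * (T (s 4) * (T (s 3) * (T (s 2) * (T (s 1) * T (s 0))))))) = 0 := by
  refine sum_even_sub (finRotate 7)⁻¹ ?_ _ _ ?_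
  · rw [Equiv.Perm.sign_inv, sign_finRotate]; norm_num
  · intro s
    have h1 : ∀ q : Fin 7, (s * (finRotate 7)⁻¹) q = s (q - 1) := by
      intro q
      rw [Equiv.Perm.mul_apply]
      congr 1
      rw [Equiv.Perm.inv_eq_iff_eq, finRotate_apply, sub_add_cancel]
    simp only [h1]
    rfl

theorem partB_term (T : Fin 7 → Module.End ℂ A) (i : Fin 7) (e : Equiv.Perm (Fin 6))
    (s : Equiv.Perm (Fin 7)) (h0 : s 0 = i) (h : ∀ q, s (Fin.succ q) = i.succAbove (e q)) :
    T i * (T (i.succAbove (e 5)) * (T (i.succAbove (e 4)) * (T (i.succAbove (e 3)) *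
      (T (i.succAbove (e 2)) * (T (i.succAbove (e 1)) * T (i.succAbove (e 0))))))) -
    T (i.succAbove (e 5)) * (T (i.succAbove (e 4)) * (T (i.succAbove (e 3)) *
      (T (i.succAbove (e 2)) * (T (i.succAbove (e 1)) * (T (i.succAbove (e 0)) * T i))))) =
        (T (s 0) * (T (s 6) * (T (s 5) * (T (s 4) * (T (s 3) * (T (s 2) * T (s 1)))))) -
         T (s 6) * (T (s 5) * (T (s 4) * (T (s 3) * (T (s 2) * (T (s 1) * T (s 0))))))) := by
  simp only [← h]
  subst h0
  rfl

theorem partB (T : Fin 7 → Module.End ℂ A) :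
    (∑ i : Fin 7, ((-1 : ℤ) ^ ((i : ℕ) + 1)) •
        ⁅T i, sEnd (fun l : Fin 6 => T (Fin.succAbove i l))⁆ = 0) := by
  have := partB_aux T
  rw [sum_perm_left] at this
  rw [← neg_eq_zero, ← Finset.sum_neg_distrib]
  refine Eq.trans (Finset.sum_congr rfl fun i _ => ?_) this
  rw [sEnd_six, Ring.lie_def, Finset.mul_sum, Finset.sum_mul, ← Finset.sum_sub_distrib,
      Finset.smul_sum, ← Finset.sum_neg_distrib]
  refine Finset.sum_congr rfl fun e _ => ?_
  rw [← partB_term T i e _ (cyc_extP_zero i e) (cyc_extP_succ i e), cyc_extP_sign]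
  rw [pow_succ, mul_smul_comm, smul_mul_assoc, ← smul_sub, smul_smul, ← neg_smul]
  simp only [mul_assoc]
  congr 1
  ring

/-- total version of the omitted index list -/
def restIdx (i J : Fin 7) (l : Fin 5) : Fin 7 :=
  if i < J then J.succAbove ((Fin.ofNat 6 i).succAbove l)
  else i.succAbove ((Fin.ofNat 6 J).succAbove l)

theorem restIdx_eq : ∀ (i : Fin 7) (j : Fin 6) (l : Fin 5),
    i.succAbove (j.succAbove l) = restIdx i (i.succAbove j) l := by
  decide

theorem restIdx_symm : ∀ (i j : Fin 7), i ≠ j → ∀ (l : Fin 5),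
    restIdx i j l = restIdx j i l := by
  decide

theorem sum_pairs {N : Type*} [AddCommGroup N] (H : Fin 7 → Fin 7 → N) :
    (∑ i : Fin 7, ∑ j : Fin 7, if i < j then ((-1 : ℤ) ^ ((i : ℕ) + (j : ℕ))) • (H i j - H j i)
      else 0) =
    -∑ i : Fin 7, ∑ j : Fin 6, ((-1 : ℤ) ^ ((i : ℕ) + (j : ℕ))) • H i (i.succAbove j) := by
  simp only [Fin.sum_univ_seven, Fin.sum_univ_six]
  simp [Fin.succAbove, Fin.lt_def]
  abel_nf

/-- Expansion of `s₆` along its first argument. -/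
theorem sEnd_cons (u : Module.End ℂ A) (r : Fin 5 → Module.End ℂ A) :
    sEnd (Fin.cons u r : Fin 6 → Module.End ℂ A) =
    ∑ κ : Equiv.Perm (Fin 5), (Equiv.Perm.sign κ : ℤ) •
      ((r (κ 4) * (r (κ 3) * (r (κ 2) * (r (κ 1) * (r (κ 0) * u))))
      - r (κ 4) * (r (κ 3) * (r (κ 2) * (r (κ 1) * (u * r (κ 0))))))
      + (r (κ 4) * (r (κ 3) * (r (κ 2) * (u * (r (κ 1) * r (κ 0)))))
      - r (κ 4) * (r (κ 3) * (u * (r (κ 2) * (r (κ 1) * r (κ 0))))))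
      + (r (κ 4) * (u * (r (κ 3) * (r (κ 2) * (r (κ 1) * r (κ 0)))))
      - u * (r (κ 4) * (r (κ 3) * (r (κ 2) * (r (κ 1) * r (κ 0))))))) := by
  rw [sEnd_six, sum_perm_right, Finset.sum_comm]
  refine Finset.sum_congr rfl fun κ _ => ?_
  have e1 : extP κ 1 = (κ 0).succ := extP_succ κ 0
  have e2 : extP κ 2 = (κ 1).succ := extP_succ κ 1
  have e3 : extP κ 3 = (κ 2).succ := extP_succ κ 2
  have e4 : extP κ 4 = (κ 3).succ := extP_succ κ 3
  have e5 : extP κ 5 = (κ 4).succ := extP_succ κ 4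
  have c : ∀ i j : Fin 6, (extP κ * Fin.cycleRange i) j =
      extP κ (if j < i then j + 1 else if j = i then 0 else j) := by
    intro i j; rw [Equiv.Perm.mul_apply, Fin.cycleRange_apply]
  simp only [cyc_extP_sign', c]
  rw [Fin.sum_univ_six]
  simp [Fin.lt_def, extP_zero, e1, e2, e3, e4, e5, smul_add, smul_sub]
  abel

theorem sum_three_zero {ι N : Type*} [Fintype ι] [AddCommGroup N] {c : ι → ℤ} (F G H : ι → N)
    (h1 : ∑ s, c s • F s = 0) (h2 : ∑ s, c s • G s = 0) (h3 : ∑ s, c s • H s = 0) :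
    ∑ s, c s • (F s + G s + H s) = 0 := by
  simp only [smul_add, Finset.sum_add_distrib, h1, h2, h3, add_zero]

theorem sum_cyc {n : ℕ} {N : Type*} [AddCommGroup N] (z o a : Fin n) (hz : z ≠ a) (ho : z ≠ o)
    (F G : Equiv.Perm (Fin n) → N)
    (h : ∀ s, F (s * (Equiv.swap z a * Equiv.swap z o)) = G s) :
    ∑ s, (Equiv.Perm.sign s : ℤ) • (F s - G s) = 0 :=
  sum_even_sub _ (by simp [Equiv.Perm.sign_swap hz, Equiv.Perm.sign_swap ho]) F G h

/-- the alternating combination of words -/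
def wordA (t : Fin 7 → Module.End ℂ A) : Module.End ℂ A :=
      ((t 6 * (t 5 * (t 4 * (t 3 * (t 2 * (t 0 * t 1)))))
      - t 6 * (t 5 * (t 4 * (t 3 * (t 0 * (t 1 * t 2))))))
      + (t 6 * (t 5 * (t 4 * (t 0 * (t 1 * (t 3 * t 2)))))
      - t 6 * (t 5 * (t 0 * (t 1 * (t 4 * (t 3 * t 2))))))
      + (t 6 * (t 0 * (t 1 * (t 5 * (t 4 * (t 3 * t 2)))))
      - t 0 * (t 1 * (t 6 * (t 5 * (t 4 * (t 3 * t 2)))))))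

theorem partA_aux (T : Fin 7 → Module.End ℂ A) : 
    ∑ s : Equiv.Perm (Fin 7), (Equiv.Perm.sign s : ℤ) • wordA (fun q => T (s q)) = 0 := by
  have h1 := sum_cyc (0 : Fin 7) 1 2 (by simp) (by simp)
    (fun s => T (s 6) * (T (s 5) * (T (s 4) * (T (s 3) * (T (s 2) * (T (s 0) * T (s 1)))))))
    (fun s => T (s 6) * (T (s 5) * (T (s 4) * (T (s 3) * (T (s 0) * (T (s 1) * T (s 2)))))))
    (fun s => by simp [Equiv.swap_apply_def])
  have h2 := sum_cyc (0 : Fin 7) 1 4 (by simp) (by simp)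
    (fun s => T (s 6) * (T (s 5) * (T (s 4) * (T (s 0) * (T (s 1) * (T (s 3) * T (s 2)))))))
    (fun s => T (s 6) * (T (s 5) * (T (s 0) * (T (s 1) * (T (s 4) * (T (s 3) * T (s 2)))))))
    (fun s => by simp [Equiv.swap_apply_def])
  have h3 := sum_cyc (0 : Fin 7) 1 6 (by simp) (by simp)
    (fun s => T (s 6) * (T (s 0) * (T (s 1) * (T (s 5) * (T (s 4) * (T (s 3) * T (s 2)))))))
    (fun s => T (s 0) * (T (s 1) * (T (s 6) * (T (s 5) * (T (s 4) * (T (s 3) * T (s 2)))))))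
    (fun s => by simp [Equiv.swap_apply_def])
  exact sum_three_zero _ _ _ h1 h2 h3

theorem partA_term (x y : Module.End ℂ A) (r : Fin 5 → Module.End ℂ A)
    (t : Fin 7 → Module.End ℂ A) (h0 : t 0 = x) (h1 : t 1 = y) (h : ∀ q, t (q.succ.succ) = r q) :
    wordA t = ((r 4 * (r 3 * (r 2 * (r 1 * (r 0 * (x * y)))))
      - r 4 * (r 3 * (r 2 * (r 1 * (x * (y * r 0))))))
      + (r 4 * (r 3 * (r 2 * (x * (y * (r 1 * r 0)))))
      - r 4 * (r 3 * (x * (y * (r 2 * (r 1 * r 0))))))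
      + (r 4 * (x * (y * (r 3 * (r 2 * (r 1 * r 0)))))
      - x * (y * (r 4 * (r 3 * (r 2 * (r 1 * r 0))))))) := by
  simp only [← h, ← h0, ← h1]
  rfl

theorem partA (T : Fin 7 → Module.End ℂ A) :
    ∑ i : Fin 7, ∑ j : Fin 6, ((-1 : ℤ) ^ ((i : ℕ) + (j : ℕ))) •
      sEnd (Fin.cons (T i * T (i.succAbove j)) (fun l => T (i.succAbove (j.succAbove l))) :
        Fin 6 → Module.End ℂ A) = 0 := by
  have h0 := partA_aux T
  rw [sum_perm_left] at h0
  refine Eq.trans (Finset.sum_congr rfl fun i _ => ?_) h0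
  rw [sum_perm_left]
  refine Finset.sum_congr rfl fun j _ => ?_
  rw [sEnd_cons, Finset.smul_sum]
  refine Finset.sum_congr rfl fun κ _ => ?_
  rw [cyc_extP_sign, cyc_extP_sign, smul_smul, pow_add, mul_assoc]
  congr 1
  simp only [mul_assoc (T i)]
  symm
  refine partA_term _ _ (fun q => T (i.succAbove (j.succAbove (κ q)))) _ ?_ ?_ ?_
  · rw [cyc_extP_zero]
  · rw [show (1 : Fin 7) = Fin.succ 0 from rfl, cyc_extP_succ, cyc_extP_zero]
  · intro q
    rw [cyc_extP_succ, cyc_extP_succ]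

theorem sEnd_cons_sub (x y : Module.End ℂ A) (r : Fin 5 → Module.End ℂ A) :
    sEnd (Fin.cons (x - y) r : Fin 6 → Module.End ℂ A) =
    sEnd (Fin.cons x r : Fin 6 → Module.End ℂ A) - sEnd (Fin.cons y r) := by
  rw [sEnd_cons, sEnd_cons, sEnd_cons, ← Finset.sum_sub_distrib]
  refine Finset.sum_congr rfl fun κ _ => ?_
  rw [← smul_sub]
  congr 1
  simp only [mul_sub, sub_mul]
  abel

theorem partA' (T : Fin 7 → Module.End ℂ A) :
    (∑ i : Fin 7, ∑ j : Fin 7, if i < j then ((-1 : ℤ) ^ ((i : ℕ) + (j : ℕ))) •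
      sEnd (Fin.cons (T i * T j - T j * T i) (fun l => T (restIdx i j l)) :
        Fin 6 → Module.End ℂ A) else 0) = 0 := by
  have := sum_pairs (fun i j => sEnd (Fin.cons (T i * T j) (fun l => T (restIdx i j l)) :
        Fin 6 → Module.End ℂ A))
  simp only [← restIdx_eq, partA, neg_zero] at this
  refine Eq.trans ?_ this
  refine Finset.sum_congr rfl fun i _ => Finset.sum_congr rfl fun j _ => ?_
  split_ifs with h
  · rw [sEnd_cons_sub]
    simp only [restIdx_symm j i h.ne']
  · rfl

end
/-- the Chevalley–Eilenberg coboundary of `s₆` vanishes on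
vector fields in two variables: both halves `d's₆` and `d''s₆` are zero, so
`s₆` is a 6-cocycle of the adjoint module and `(Vect(2), {s₂, s₆})` is an
sh-Lie algebra. -/
theorem stmt_18 (X : Fin 7 → Vect 2) :
    (∑ i : Fin 7, ∑ j : Fin 7,
      (if h : i < j then
        ((-1 : ℤ) ^ ((i : ℕ) + (j : ℕ))) •
          sEnd (Fin.cons (⁅X i, X j⁆ : Vect 2).toLinearMap
            (fun l : Fin 5 =>
              (X (Fin.succAbove j
                (Fin.succAbove (⟨(i : ℕ), by
                  have hj := j.isLt
                  have h' : (i : ℕ) < (j : ℕ) := h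
                  omega⟩ : Fin 6) l))).toLinearMap))
      else 0) = 0) ∧
    (∑ i : Fin 7,
      ((-1 : ℤ) ^ ((i : ℕ) + 1)) •
        ⁅(X i).toLinearMap,
          sEnd (fun l : Fin 6 => (X (Fin.succAbove i l)).toLinearMap)⁆ = 0) := by
  constructor
  swap
  · have hB := partB (A := MvPolynomial (Fin 2) ℂ) fun i => (X i).toLinearMap
    refine Eq.trans (Finset.sum_congr rfl fun i _ => ?_) hB
    congr 1
  refine Eq.trans ?_ (partA' (A := MvPolynomial (Fin 2) ℂ) fun i => (X i).toLinearMap)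
  refine Finset.sum_congr rfl fun i _ => Finset.sum_congr rfl fun j _ => ?_
  by_cases h : i < j
  · rw [dif_pos h, if_pos h]
    have hr : ∀ l, restIdx i j l = Fin.succAbove j
        (Fin.succAbove (⟨(i : ℕ), by have := j.isLt; omega⟩ : Fin 6) l) := by
      intro l
      rw [restIdx, if_pos h]
      congr 2
      ext
      simp [Fin.ofNat]
      omega
    simp only [hr]
    congr 1
  · rw [dif_neg h, if_neg h]
end

section
/- Let U be a commutative ring that is an algebra over ℂ, and let d₁, d₂ ∈ Derivation ℂ U U be commuting derivations (d₁ (d₂ u) = d₂ (d₁ u) for all u ∈ U). Then for all u₁, …, u₅ ∈ U one has s₅(D₁₂ u₁, D₁₂ u₂, D₁₂ u₃, D₁₂ u₄, D₁₂ u₅) = (−3) • D₁₂ ([u₁, u₂, u₃, u₄, u₅]) as ℂ-linear endomorphisms of U, where [u₁, u₂, u₃, u₄, u₅] ∈ U is the determinant of the 5×5 matrix over U whose j-th column is (d₁ uⱼ, d₂ uⱼ, d₁ (d₁ uⱼ), d₁ (d₂ uⱼ), d₂ (d₂ uⱼ)). -/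
noncomputable section

/-- The divergence-free vector field `D₁₂ u = (d₁ u) • d₂ − (d₂ u) • d₁`. -/
def D12 {U : Type*} [CommRing U] [Algebra ℂ U]
    (d₁ d₂ : Derivation ℂ U U) (u : U) : Derivation ℂ U U :=
  (d₁ u) • d₂ - (d₂ u) • d₁


theorem sEnd_succ {A : Type*} [AddCommGroup A] [Module ℂ A] {k : ℕ}
    (T : Fin (k + 1) → Module.End ℂ A) :
    sEnd T = ∑ p : Fin (k + 1), (if p = 0 then (1 : ℤ) else -1) •
      (sEnd (fun x : Fin k => T (Equiv.swap 0 p x.succ)) * T p) := by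
  unfold sEnd
  rw [← Equiv.sum_comp Equiv.Perm.decomposeFin.symm, Fintype.sum_prod_type]
  refine Finset.sum_congr rfl fun p _ => ?_
  rw [Finset.sum_mul, Finset.smul_sum]
  refine Finset.sum_congr rfl fun e _ => ?_
  rw [List.ofFn_succ, List.reverse_cons, List.prod_append]
  simp only [Equiv.Perm.decomposeFin_symm_apply_zero, Equiv.Perm.decomposeFin_symm_apply_succ,
    Equiv.Perm.decomposeFin.symm_sign, List.prod_singleton, smul_mul_assoc, smul_smul]
  split_ifs <;> simp

theorem sEnd_zero_s19 {A : Type*} [AddCommGroup A] [Module ℂ A]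
    (T : Fin 0 → Module.End ℂ A) : sEnd T = 1 := by
  simp [sEnd]

theorem sEnd_two {A : Type*} [AddCommGroup A] [Module ℂ A]
    (T : Fin 2 → Module.End ℂ A) : sEnd T = T 1 * T 0 - T 0 * T 1 := by
  simp [sEnd_succ, sEnd_zero_s19, Fin.sum_univ_succ]
  abel

theorem sEnd_three {A : Type*} [AddCommGroup A] [Module ℂ A]
    (T : Fin 3 → Module.End ℂ A) :
    sEnd T = sEnd (fun x => T ((![1, 2] : Fin 2 → Fin 3) x)) * T 0
      - sEnd (fun x => T ((![0, 2] : Fin 2 → Fin 3) x)) * T 1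
      - sEnd (fun x => T ((![1, 0] : Fin 2 → Fin 3) x)) * T 2 := by
  have h0 : ∀ x : Fin 2, Equiv.swap (0 : Fin 3) 0 x.succ =
      (![1, 2] : Fin 2 → Fin 3) x := by decide
  have h1 : ∀ x : Fin 2, Equiv.swap (0 : Fin 3) 1 x.succ =
      (![0, 2] : Fin 2 → Fin 3) x := by decide
  have h2 : ∀ x : Fin 2, Equiv.swap (0 : Fin 3) 2 x.succ =
      (![1, 0] : Fin 2 → Fin 3) x := by decide
  have h : sEnd T = ∑ p : Fin 3, (if p = 0 then (1 : ℤ) else -1) •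
      (sEnd (fun x : Fin 2 => T (Equiv.swap 0 p x.succ)) * T p) := sEnd_succ T
  rw [h, Fin.sum_univ_three]
  simp only [h0, h1, h2]
  simp [← sub_eq_add_neg]

theorem sEnd_four_aux {A : Type*} [AddCommGroup A] [Module ℂ A]
    (T : Fin 4 → Module.End ℂ A) :
    sEnd T = sEnd (fun x => T ((![1, 2, 3] : Fin 3 → Fin 4) x)) * T 0
      - sEnd (fun x => T ((![0, 2, 3] : Fin 3 → Fin 4) x)) * T 1
      - sEnd (fun x => T ((![1, 0, 3] : Fin 3 → Fin 4) x)) * T 2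
      - sEnd (fun x => T ((![1, 2, 0] : Fin 3 → Fin 4) x)) * T 3 := by
  have h0 : ∀ x : Fin 3, Equiv.swap (0 : Fin 4) 0 x.succ =
      (![1, 2, 3] : Fin 3 → Fin 4) x := by decide
  have h1 : ∀ x : Fin 3, Equiv.swap (0 : Fin 4) 1 x.succ =
      (![0, 2, 3] : Fin 3 → Fin 4) x := by decide
  have h2 : ∀ x : Fin 3, Equiv.swap (0 : Fin 4) 2 x.succ =
      (![1, 0, 3] : Fin 3 → Fin 4) x := by decide
  have h3 : ∀ x : Fin 3, Equiv.swap (0 : Fin 4) 3 x.succ =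
      (![1, 2, 0] : Fin 3 → Fin 4) x := by decide
  have h : sEnd T = ∑ p : Fin 4, (if p = 0 then (1 : ℤ) else -1) •
      (sEnd (fun x : Fin 3 => T (Equiv.swap 0 p x.succ)) * T p) := sEnd_succ T
  rw [h, Fin.sum_univ_four]
  simp only [h0, h1, h2, h3]
  simp [← sub_eq_add_neg]

theorem sEnd_five {A : Type*} [AddCommGroup A] [Module ℂ A]
    (T : Fin 5 → Module.End ℂ A) :
    sEnd T = sEnd (fun x => T ((![1, 2, 3, 4] : Fin 4 → Fin 5) x)) * T 0
      - sEnd (fun x => T ((![0, 2, 3, 4] : Fin 4 → Fin 5) x)) * T 1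
      - sEnd (fun x => T ((![1, 0, 3, 4] : Fin 4 → Fin 5) x)) * T 2
      - sEnd (fun x => T ((![1, 2, 0, 4] : Fin 4 → Fin 5) x)) * T 3
      - sEnd (fun x => T ((![1, 2, 3, 0] : Fin 4 → Fin 5) x)) * T 4 := by
  have h0 : ∀ x : Fin 4, Equiv.swap (0 : Fin 5) 0 x.succ =
      (![1, 2, 3, 4] : Fin 4 → Fin 5) x := by decide
  have h1 : ∀ x : Fin 4, Equiv.swap (0 : Fin 5) 1 x.succ =
      (![0, 2, 3, 4] : Fin 4 → Fin 5) x := by decide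
  have h2 : ∀ x : Fin 4, Equiv.swap (0 : Fin 5) 2 x.succ =
      (![1, 0, 3, 4] : Fin 4 → Fin 5) x := by decide
  have h3 : ∀ x : Fin 4, Equiv.swap (0 : Fin 5) 3 x.succ =
      (![1, 2, 0, 4] : Fin 4 → Fin 5) x := by decide
  have h4 : ∀ x : Fin 4, Equiv.swap (0 : Fin 5) 4 x.succ =
      (![1, 2, 3, 0] : Fin 4 → Fin 5) x := by decide
  have h : sEnd T = ∑ p : Fin 5, (if p = 0 then (1 : ℤ) else -1) •
      (sEnd (fun x : Fin 4 => T (Equiv.swap 0 p x.succ)) * T p) := sEnd_succ T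
  rw [h, Fin.sum_univ_five]
  simp only [h0, h1, h2, h3, h4]
  simp [← sub_eq_add_neg]

theorem sEnd_four {A : Type*} [AddCommGroup A] [Module ℂ A]
    (T : Fin 4 → Module.End ℂ A) (C : Fin 4 → Fin 4 → Module.End ℂ A)
    (hC : ∀ i j, C i j = T i * T j - T j * T i) :
    sEnd T = C 0 1 * C 2 3 + C 2 3 * C 0 1 - C 0 2 * C 1 3 - C 1 3 * C 0 2
      + C 0 3 * C 1 2 + C 1 2 * C 0 3 := by
  simp only [hC]
  rw [sEnd_four_aux]
  simp only [sEnd_three, sEnd_two]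
  simp
  noncomm_ring

/-- The explicit `4 × 4` determinant with rows `a, b, c, d`. -/
def dt4 {U : Type*} [CommRing U] (a b c d : Fin 4 → U) : U :=
  (a 0 * b 1 - a 1 * b 0) * (c 2 * d 3 - c 3 * d 2)
  - (a 0 * b 2 - a 2 * b 0) * (c 1 * d 3 - c 3 * d 1)
  + (a 0 * b 3 - a 3 * b 0) * (c 1 * d 2 - c 2 * d 1)
  + (a 1 * b 2 - a 2 * b 1) * (c 0 * d 3 - c 3 * d 0)
  - (a 1 * b 3 - a 3 * b 1) * (c 0 * d 2 - c 2 * d 0)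
  + (a 2 * b 3 - a 3 * b 2) * (c 0 * d 1 - c 1 * d 0)

theorem D12_comm {U : Type*} [CommRing U] [Algebra ℂ U]
    (d₁ d₂ : Derivation ℂ U U) (hcomm : ∀ u : U, d₁ (d₂ u) = d₂ (d₁ u)) (a b : U) :
    (D12 d₁ d₂ (d₁ a * d₂ b - d₂ a * d₁ b)).toLinearMap =
      ((D12 d₁ d₂ a).toLinearMap * (D12 d₁ d₂ b).toLinearMap
        - (D12 d₁ d₂ b).toLinearMap * (D12 d₁ d₂ a).toLinearMap : Module.End ℂ U) := by
  ext f
  simp [D12, hcomm]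
  ring

theorem s4_formula {U : Type*} [CommRing U] [Algebra ℂ U]
    (d₁ d₂ : Derivation ℂ U U) (hcomm : ∀ u : U, d₁ (d₂ u) = d₂ (d₁ u))
    (u p q r s t a b c d : Fin 4 → U) (f : U)
    (hp : ∀ i, d₁ (u i) = p i) (hq : ∀ i, d₂ (u i) = q i)
    (hr : ∀ i, d₁ (p i) = r i) (hs : ∀ i, d₂ (p i) = s i)
    (hs' : ∀ i, d₁ (q i) = s i) (ht : ∀ i, d₂ (q i) = t i)
    (ha : ∀ i, d₁ (r i) = a i) (hb : ∀ i, d₂ (r i) = b i)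
    (hb' : ∀ i, d₁ (s i) = b i) (hc : ∀ i, d₂ (s i) = c i)
    (hc' : ∀ i, d₁ (t i) = c i) (hd : ∀ i, d₂ (t i) = d i) :
    sEnd (fun j => (D12 d₁ d₂ (u j)).toLinearMap) f =
      -2 * dt4 p q s t * d₁ (d₁ f) + 2 * dt4 p q r t * d₂ (d₁ f) - 2 * dt4 p q r s * d₂ (d₂ f)
      + (3 * dt4 q r s t + dt4 p q r d - 2 * dt4 p q s c + dt4 p q t b) * d₁ f
      + (- dt4 p q r c + 2 * dt4 p q s b - 3 * dt4 p r s t - dt4 p q t a) * d₂ f := by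
  rw [sEnd_four _ (fun i j => (D12 d₁ d₂ (d₁ (u i) * d₂ (u j) - d₂ (u i) * d₁ (u j))).toLinearMap)
    (fun i j => D12_comm d₁ d₂ hcomm _ _)]
  simp only [D12, hp, hq, LinearMap.add_apply, LinearMap.sub_apply, Module.End.mul_apply,
    Derivation.coeFn_coe, Derivation.sub_apply,
    Derivation.smul_apply, smul_eq_mul, map_sub, map_add, Derivation.leibniz,
    hr, hs, hs', ht, ha, hb, hb', hc, hc', hd, hcomm, dt4]
  generalize d₁ f = f1, d₂ f = f2
  ring

/-- The explicit `5 × 5` determinant with rows `a, b, c, d, e`. -/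
def dt5 {U : Type*} [CommRing U] (a b c d e : Fin 5 → U) : U :=
  a 0 * dt4 (fun x => b ((![1, 2, 3, 4] : Fin 4 → Fin 5) x)) (fun x => c ((![1, 2, 3, 4] : Fin 4 → Fin 5) x)) (fun x => d ((![1, 2, 3, 4] : Fin 4 → Fin 5) x)) (fun x => e ((![1, 2, 3, 4] : Fin 4 → Fin 5) x))
    - a 1 * dt4 (fun x => b ((![0, 2, 3, 4] : Fin 4 → Fin 5) x)) (fun x => c ((![0, 2, 3, 4] : Fin 4 → Fin 5) x)) (fun x => d ((![0, 2, 3, 4] : Fin 4 → Fin 5) x)) (fun x => e ((![0, 2, 3, 4] : Fin 4 → Fin 5) x))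
    - a 2 * dt4 (fun x => b ((![1, 0, 3, 4] : Fin 4 → Fin 5) x)) (fun x => c ((![1, 0, 3, 4] : Fin 4 → Fin 5) x)) (fun x => d ((![1, 0, 3, 4] : Fin 4 → Fin 5) x)) (fun x => e ((![1, 0, 3, 4] : Fin 4 → Fin 5) x))
    - a 3 * dt4 (fun x => b ((![1, 2, 0, 4] : Fin 4 → Fin 5) x)) (fun x => c ((![1, 2, 0, 4] : Fin 4 → Fin 5) x)) (fun x => d ((![1, 2, 0, 4] : Fin 4 → Fin 5) x)) (fun x => e ((![1, 2, 0, 4] : Fin 4 → Fin 5) x))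
    - a 4 * dt4 (fun x => b ((![1, 2, 3, 0] : Fin 4 → Fin 5) x)) (fun x => c ((![1, 2, 3, 0] : Fin 4 → Fin 5) x)) (fun x => d ((![1, 2, 3, 0] : Fin 4 → Fin 5) x)) (fun x => e ((![1, 2, 3, 0] : Fin 4 → Fin 5) x))

theorem det_eq_dt5 {U : Type*} [CommRing U] (M : Matrix (Fin 5) (Fin 5) U) :
    M.det = dt5 (M 0) (M 1) (M 2) (M 3) (M 4) := by
  rw [Matrix.det_succ_row_zero]
  simp [Matrix.det_succ_row_zero, Fin.sum_univ_succ, Fin.succAbove, dt5, dt4]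
  ring

theorem derivation_dt5 {U : Type*} [CommRing U] [Algebra ℂ U] (D : Derivation ℂ U U)
    (a b c d e : Fin 5 → U) :
    D (dt5 a b c d e) = dt5 (fun i => D (a i)) b c d e + dt5 a (fun i => D (b i)) c d e
      + dt5 a b (fun i => D (c i)) d e + dt5 a b c (fun i => D (d i)) e
      + dt5 a b c d (fun i => D (e i)) := by
  simp only [dt5, dt4, map_sub, map_add, Derivation.leibniz, smul_eq_mul]
  ring

theorem dt5_perm_12354 {U : Type*} [CommRing U] (v w x y z : Fin 5 → U) :
    dt5 v w x z y = -dt5 v w x y z := by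
  simp only [dt5, dt4, Matrix.cons_val]
  ring

theorem dt5_perm_12534 {U : Type*} [CommRing U] (v w x y z : Fin 5 → U) :
    dt5 v w z x y = dt5 v w x y z := by
  simp only [dt5, dt4, Matrix.cons_val]
  ring

theorem dt5_perm_21345 {U : Type*} [CommRing U] (v w x y z : Fin 5 → U) :
    dt5 w v x y z = -dt5 v w x y z := by
  simp only [dt5, dt4, Matrix.cons_val]
  ring

theorem dt5_perm_31245 {U : Type*} [CommRing U] (v w x y z : Fin 5 → U) :
    dt5 x v w y z = dt5 v w x y z := by
  simp only [dt5, dt4, Matrix.cons_val]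
  ring

theorem dt5_perm_41235 {U : Type*} [CommRing U] (v w x y z : Fin 5 → U) :
    dt5 y v w x z = -dt5 v w x y z := by
  simp only [dt5, dt4, Matrix.cons_val]
  ring

theorem dt5_perm_51234 {U : Type*} [CommRing U] (v w x y z : Fin 5 → U) :
    dt5 z v w x y = dt5 v w x y z := by
  simp only [dt5, dt4, Matrix.cons_val]
  ring

theorem dt5_zero_12 {U : Type*} [CommRing U] (v x y z : Fin 5 → U) :
    dt5 v v x y z = 0 := by
  simp only [dt5, dt4, Matrix.cons_val]
  ring

theorem dt5_zero_13 {U : Type*} [CommRing U] (v w y z : Fin 5 → U) :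
    dt5 v w v y z = 0 := by
  simp only [dt5, dt4, Matrix.cons_val]
  ring

theorem dt5_zero_14 {U : Type*} [CommRing U] (v w x z : Fin 5 → U) :
    dt5 v w x v z = 0 := by
  simp only [dt5, dt4, Matrix.cons_val]
  ring

theorem dt5_zero_15 {U : Type*} [CommRing U] (v w x y : Fin 5 → U) :
    dt5 v w x y v = 0 := by
  simp only [dt5, dt4, Matrix.cons_val]
  ring

theorem dt5_zero_24 {U : Type*} [CommRing U] (v w x z : Fin 5 → U) :
    dt5 v w x w z = 0 := by
  simp only [dt5, dt4, Matrix.cons_val]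
  ring

theorem dt5_zero_25 {U : Type*} [CommRing U] (v w x y : Fin 5 → U) :
    dt5 v w x y w = 0 := by
  simp only [dt5, dt4, Matrix.cons_val]
  ring

set_option maxHeartbeats 4000000 in
set_option maxRecDepth 100000 in
/-- for commuting derivations `d₁, d₂` of a commutative `ℂ`-algebra `U`,
`s₅(D₁₂ u₁, …, D₁₂ u₅) = (−3) • D₁₂ [u₁,…,u₅]`, where `[u₁,…,u₅]` is the `5 × 5`
determinant whose `j`-th column is `(d₁ uⱼ, d₂ uⱼ, d₁ d₁ uⱼ, d₁ d₂ uⱼ, d₂ d₂ uⱼ)`. -/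
theorem stmt_19 (U : Type*) [CommRing U] [Algebra ℂ U]
    (d₁ d₂ : Derivation ℂ U U) (hcomm : ∀ u : U, d₁ (d₂ u) = d₂ (d₁ u))
    (u : Fin 5 → U) :
    sEnd (fun j => (D12 d₁ d₂ (u j)).toLinearMap) =
      (-3 : ℤ) • (D12 d₁ d₂ (Matrix.det (Matrix.of fun i j : Fin 5 =>
        (![fun v => d₁ v, fun v => d₂ v, fun v => d₁ (d₁ v),
           fun v => d₁ (d₂ v), fun v => d₂ (d₂ v)] : Fin 5 → U → U) i (u j)))).toLinearMap := by
  have hdet := det_eq_dt5 (Matrix.of fun i j : Fin 5 =>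
        (![fun v => d₁ v, fun v => d₂ v, fun v => d₁ (d₁ v),
           fun v => d₁ (d₂ v), fun v => d₂ (d₂ v)] : Fin 5 → U → U) i (u j))
  replace hdet := hdet.trans (show _ = dt5 (fun j => d₁ (u j)) (fun j => d₂ (u j))
    (fun j => d₁ (d₁ (u j))) (fun j => d₁ (d₂ (u j))) (fun j => d₂ (d₂ (u j))) from rfl)
  rw [hdet]
  ext f
  rw [sEnd_five]
  have key := fun (e : Fin 4 → Fin 5) (g : U) =>
    s4_formula d₁ d₂ hcomm (fun x => u (e x))
      (fun x => d₁ (u (e x)))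
      (fun x => d₂ (u (e x)))
      (fun x => d₁ (d₁ (u (e x))))
      (fun x => d₂ (d₁ (u (e x))))
      (fun x => d₂ (d₂ (u (e x))))
      (fun x => d₁ (d₁ (d₁ (u (e x)))))
      (fun x => d₂ (d₁ (d₁ (u (e x)))))
      (fun x => d₂ (d₂ (d₁ (u (e x)))))
      (fun x => d₂ (d₂ (d₂ (u (e x))))) g
      (fun _ => rfl) (fun _ => rfl) (fun _ => rfl) (fun _ => rfl) (fun _ => hcomm _) (fun _ => rfl) (fun _ => rfl) (fun _ => rfl) (fun i => by simp only [hcomm]) (fun _ => rfl) (fun i => by simp only [hcomm]) (fun _ => rfl)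
  simp only [LinearMap.sub_apply, Module.End.mul_apply, key]
  simp only [D12, Derivation.coeFn_coe, Derivation.sub_apply,
    LinearMap.smul_apply,
    Derivation.smul_apply, smul_eq_mul, map_sub, map_add, Derivation.leibniz, derivation_dt5]
  simp only [hcomm, zsmul_eq_mul, Int.cast_neg, Int.cast_ofNat]
  clear key hdet
  obtain ⟨p, hp⟩ : ∃ g : Fin 5 → U, g = fun j => d₁ (u j) := ⟨_, rfl⟩
  obtain ⟨q, hq⟩ : ∃ g : Fin 5 → U, g = fun j => d₂ (u j) := ⟨_, rfl⟩
  obtain ⟨r, hr⟩ : ∃ g : Fin 5 → U, g = fun j => d₁ (d₁ (u j)) := ⟨_, rfl⟩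
  obtain ⟨s, hs⟩ : ∃ g : Fin 5 → U, g = fun j => d₂ (d₁ (u j)) := ⟨_, rfl⟩
  obtain ⟨t, ht⟩ : ∃ g : Fin 5 → U, g = fun j => d₂ (d₂ (u j)) := ⟨_, rfl⟩
  obtain ⟨a, ha⟩ : ∃ g : Fin 5 → U, g = fun j => d₁ (d₁ (d₁ (u j))) := ⟨_, rfl⟩
  obtain ⟨b, hb⟩ : ∃ g : Fin 5 → U, g = fun j => d₂ (d₁ (d₁ (u j))) := ⟨_, rfl⟩
  obtain ⟨c, hc⟩ : ∃ g : Fin 5 → U, g = fun j => d₂ (d₂ (d₁ (u j))) := ⟨_, rfl⟩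
  obtain ⟨d, hd⟩ : ∃ g : Fin 5 → U, g = fun j => d₂ (d₂ (d₂ (u j))) := ⟨_, rfl⟩
  have h0 := dt5_perm_51234 p q s t a
  have h1 := dt5_perm_51234 p q r t b
  have h2 := dt5_perm_51234 p q s t b
  have h3 := dt5_perm_51234 p q r s c
  have h4 := dt5_perm_51234 p q r t c
  have h5 := dt5_perm_51234 p q r s d
  have h6 := dt5_zero_12 p q r c
  have h7 := dt5_zero_12 p q r d
  have h8 := dt5_zero_12 p q r s
  have h9 := dt5_zero_12 p q r t
  have h10 := dt5_zero_12 p q s b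
  have h11 := dt5_zero_12 p q s c
  have h12 := dt5_zero_12 p q s t
  have h13 := dt5_zero_12 p q t a
  have h14 := dt5_zero_12 p q t b
  have h15 := dt5_zero_12 p r s t
  have h16 := dt5_perm_12534 p q s t a
  have h17 := dt5_perm_12534 p q s t b
  have h18 := dt5_perm_12354 p q r t b
  have h19 := dt5_perm_12354 p q r t c
  have h20 := dt5_zero_24 p s r t
  have h21 := dt5_zero_25 p t r s
  have h22 := dt5_zero_13 q p r c
  have h23 := dt5_zero_13 q p r d
  have h24 := dt5_zero_13 q p r s
  have h25 := dt5_zero_13 q p r t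
  have h26 := dt5_zero_13 q p s b
  have h27 := dt5_zero_13 q p s c
  have h28 := dt5_zero_13 q p s t
  have h29 := dt5_zero_13 q p t a
  have h30 := dt5_zero_13 q p t b
  have h31 := dt5_perm_21345 p q r s t
  have h32 := dt5_zero_12 q r s t
  have h33 := dt5_zero_14 r p q d
  have h34 := dt5_zero_14 r p q t
  have h35 := dt5_perm_31245 p q r s c
  have h36 := dt5_perm_31245 p q r s t
  have h37 := dt5_perm_31245 p q r t b
  have h38 := dt5_zero_13 r q s t
  have h39 := dt5_perm_41235 p q r s c
  have h40 := dt5_perm_41235 p q r s d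
  have h41 := dt5_zero_15 s p q r
  have h42 := dt5_zero_14 s p q b
  have h43 := dt5_zero_14 s p q c
  have h44 := dt5_zero_14 s p q t
  have h45 := dt5_perm_31245 p q s t a
  have h46 := dt5_perm_31245 p q s t b
  have h47 := dt5_zero_14 s p r t
  have h48 := dt5_zero_14 s q r t
  have h49 := dt5_perm_41235 p q r t c
  have h50 := dt5_perm_51234 p q r s t
  have h51 := dt5_zero_15 t p q r
  have h52 := dt5_perm_41235 p q s t b
  have h53 := dt5_zero_14 t p q a
  have h54 := dt5_zero_15 t p r s
  simp only [dt5, hp, hq, hr, hs, ht, ha, hb, hc, hd] at h0 h1 h2 h3 h4 h5 h6 h7 h8 h9 h10 h11 h12 h13 h14 h15 h16 h17 h18 h19 h20 h21 h22 h23 h24 h25 h26 h27 h28 h29 h30 h31 h32 h33 h34 h35 h36 h37 h38 h39 h40 h41 h42 h43 h44 h45 h46 h47 h48 h49 h50 h51 h52 h53 h54 ⊢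
  linear_combination (-2) * d₂ f * h0
    + (2) * d₂ f * h1
    + (2) * d₁ f * h2
    + (-2) * d₂ f * h3
    + (-2) * d₁ f * h4
    + (2) * d₁ f * h5
    + (-1) * d₂ (d₂ f) * h6
    + (1) * d₂ (d₁ f) * h7
    + (-2) * d₂ (d₂ (d₂ f)) * h8
    + (2) * d₂ (d₂ (d₁ f)) * h9
    + (2) * d₂ (d₂ f) * h10
    + (-2) * d₂ (d₁ f) * h11
    + (-2) * d₂ (d₁ (d₁ f)) * h12
    + (-1) * d₂ (d₂ f) * h13
    + (1) * d₂ (d₁ f) * h14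
    + (-3) * d₂ (d₂ f) * h15
    + (3) * d₂ f * h16
    + (-3) * d₁ f * h17
    + (3) * d₂ f * h18
    + (-3) * d₁ f * h19
    + (3) * d₂ f * h20
    + (-3) * d₁ f * h21
    + (1) * d₂ (d₁ f) * h22
    + (-1) * d₁ (d₁ f) * h23
    + (2) * d₂ (d₂ (d₁ f)) * h24
    + (-2) * d₂ (d₁ (d₁ f)) * h25
    + (-2) * d₂ (d₁ f) * h26
    + (2) * d₁ (d₁ f) * h27
    + (2) * d₁ (d₁ (d₁ f)) * h28
    + (1) * d₂ (d₁ f) * h29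
    + (-1) * d₁ (d₁ f) * h30
    + (3) * d₂ (d₁ f) * h31
    + (-3) * d₁ (d₁ f) * h32
    + (1) * d₂ f * h33
    + (2) * d₂ (d₂ f) * h34
    + (-2) * d₂ f * h35
    + (-4) * d₂ (d₁ f) * h36
    + (1) * d₂ f * h37
    + (6) * d₂ f * h38
    + (-1) * d₂ f * h39
    + (-1) * d₁ f * h40
    + (-4) * d₂ (d₂ f) * h41
    + (2) * d₂ f * h42
    + (2) * d₁ f * h43
    + (4) * d₁ (d₁ f) * h44
    + (-1) * d₂ f * h45
    + (-1) * d₁ f * h46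
    + (-3) * d₂ f * h47
    + (-6) * d₁ f * h48
    + (1) * d₁ f * h49
    + (4) * d₂ (d₁ f) * h50
    + (-2) * d₁ (d₁ f) * h51
    + (-2) * d₁ f * h52
    + (1) * d₁ f * h53
    + (3) * d₁ f * h54

end
end
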